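/- Let $d\ge 1$ and $\alpha\in(0,\min(2,d))$. There exists a constant $C>0$ such that for all integers $n\ge 2$: $\int_0^{\infty} \sup_{x\in Q}\; \|G_d(t,x,\cdot)-(G_d)^n(t,x,\cdot)\|_{(\alpha)}^2\, dt \le C\, n^{-(2-\alpha)}$. -/

import Mathlib

open MeasureTheory

/-- `φ_j(ξ) = √2 sin(jπξ)`. -/
noncomputable def phiF (j : ℕ) (ξ : ℝ) : ℝ := Real.sqrt 2 * Real.sin ((j : ℝ) * Real.pi * ξ)

/-- Green function of the heat operator on `[0,1]` with homogeneous
Dirichlet boundary conditions: `G(t,x,y) = ∑_{j≥1} e^{-j²π²t} φ_j(x) φ_j(y)`. -/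
noncomputable def G (t x y : ℝ) : ℝ :=
  ∑' j : ℕ, Real.exp (-((j : ℝ) + 1) ^ 2 * Real.pi ^ 2 * t) * phiF (j + 1) x * phiF (j + 1) y

/-- The cube `Q = [0,1]^d`. -/
def Q (d : ℕ) : Set (EuclideanSpace ℝ (Fin d)) := {x | ∀ i, x i ∈ Set.Icc (0 : ℝ) 1}

/-- `G_d(t,x,y) = ∏_i G(t,x_i,y_i)` on `Q = [0,1]^d`. -/
noncomputable def Gd (d : ℕ) (t : ℝ) (x y : EuclideanSpace ℝ (Fin d)) : ℝ :=
  ∏ i, G t (x i) (y i)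

/-- `‖φ‖_{(α)}² = ∫_Q ∫_Q |φ(y)| |y-z|^{-α} |φ(z)| dy dz`. -/
noncomputable def normAlphaSq (d : ℕ) (α : ℝ) (f : EuclideanSpace ℝ (Fin d) → ℝ) : ℝ :=
  ∫ y in Q d, ∫ z in Q d, |f y| * ‖y - z‖ ^ (-α) * |f z|

/-- `κ_n(y) = ⌊ny⌋/n`. -/
noncomputable def kappa (n : ℕ) (y : ℝ) : ℝ := (⌊(n : ℝ) * y⌋ : ℝ) / n

/-- `λ_j^n = -4n² sin²(jπ/(2n))`. -/
noncomputable def lamn (n j : ℕ) : ℝ :=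
  -4 * (n : ℝ) ^ 2 * Real.sin ((j : ℝ) * Real.pi / (2 * n)) ^ 2

/-- Piecewise-linear interpolation of `φ_j` on the grid `{i/n : 0 ≤ i ≤ n}`. -/
noncomputable def phiLin (n j : ℕ) (x : ℝ) : ℝ :=
  phiF j ((⌊(n : ℝ) * x⌋ : ℝ) / n) +
    ((n : ℝ) * x - (⌊(n : ℝ) * x⌋ : ℝ)) *
      (phiF j (((⌊(n : ℝ) * x⌋ : ℝ) + 1) / n) - phiF j ((⌊(n : ℝ) * x⌋ : ℝ) / n))

/-- Space-discretized Green function on `[0,1]`: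
`G^n(t,x,y) = ∑_{j=1}^{n-1} e^{λ_j^n t} φ_j^n(x) φ_j(κ_n(y))`. -/
noncomputable def Gn (n : ℕ) (t x y : ℝ) : ℝ :=
  ∑ j ∈ Finset.Icc 1 (n - 1), Real.exp (lamn n j * t) * phiLin n j x * phiF j (kappa n y)

/-- `(G_d)^n(t,x,y) = ∏_i G^n(t,x_i,y_i)`. -/
noncomputable def Gdn (d n : ℕ) (t : ℝ) (x y : EuclideanSpace ℝ (Fin d)) : ℝ :=
  ∏ i, Gn n t (x i) (y i)

lemma measSet_Q (d : ℕ) : MeasurableSet (Q d) := by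
  have : Q d = ⋂ i : Fin d, (fun x : EuclideanSpace ℝ (Fin d) => x i) ⁻¹' Set.Icc (0:ℝ) 1 := by
    ext x; simp [Q]
  rw [this]
  refine MeasurableSet.iInter fun i => ?_
  have hm : Measurable (fun x : EuclideanSpace ℝ (Fin d) => x i) := by fun_prop
  exact hm measurableSet_Icc

/-- truncated Riesz kernel -/
noncomputable def rieszK (d : ℕ) (α r : ℝ) (w : EuclideanSpace ℝ (Fin d)) : ℝ :=
  (Metric.ball (0 : EuclideanSpace ℝ (Fin d)) r).indicator (fun w => ‖w‖ ^ (-α)) w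

lemma rieszK_nonneg (d : ℕ) (α r : ℝ) (w : EuclideanSpace ℝ (Fin d)) : 0 ≤ rieszK d α r w := by
  unfold rieszK
  exact Set.indicator_nonneg (fun x _ => by positivity) _

lemma rieszK_integrable (d : ℕ) (hd : 1 ≤ d) (α : ℝ) (h1 : α < d) (r : ℝ) :
    Integrable (rieszK d α r) := by
  have : Nonempty (Fin d) := ⟨⟨0, hd⟩⟩
  have : Nontrivial (EuclideanSpace ℝ (Fin d)) := inferInstance
  unfold rieszK
  rw [integrable_indicator_iff measurableSet_ball]
  have := (integrableOn_fun_norm_addHaar (E := EuclideanSpace ℝ (Fin d)) volume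
    (f := fun s : ℝ => s ^ (-α)) (r := r))
  refine this.2 ?_
  simp only [finrank_euclideanSpace, Fintype.card_fin, smul_eq_mul]
  have h2 : IntegrableOn (fun y : ℝ => y ^ ((d:ℝ) - 1 - α)) (Set.Ioo 0 r) := by
    rcases le_or_gt r 0 with hr | hr
    · simp [Set.Ioo_eq_empty_of_le hr]
    have := (intervalIntegral.intervalIntegrable_rpow' (a := 0) (b := r) (r := (d:ℝ) - 1 - α) (by linarith))
    rw [intervalIntegrable_iff_integrableOn_Ioo_of_le hr.le] at this
    exact this
  refine h2.congr_fun ?_ measurableSet_Ioo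
  intro y hy
  have hy0 : 0 < y := hy.1
  simp only
  rw [← Real.rpow_natCast, ← Real.rpow_add hy0]
  congr 1
  rw [Nat.cast_sub hd]; push_cast; ring

lemma rieszK_integral (d : ℕ) (α r : ℝ) (hr : 0 < r) :
    ∫ w, rieszK d α r w = r ^ ((d:ℝ) - α) * ∫ w, rieszK d α 1 w := by
  have h : ∀ w, rieszK d α r w = r ^ (-α) * rieszK d α 1 (r⁻¹ • w) := by
    intro w
    unfold rieszK
    by_cases hw : ‖w‖ < r
    · have h2 : ‖r⁻¹ • w‖ < 1 := by
        rw [norm_smul, Real.norm_eq_abs, abs_of_pos (inv_pos.2 hr)]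
        rw [inv_mul_lt_iff₀ hr]; simpa using hw
      rw [Set.indicator_of_mem (by simpa using hw), Set.indicator_of_mem (by simpa using h2)]
      rw [norm_smul, Real.norm_eq_abs, abs_of_pos (inv_pos.2 hr),
        ← Real.mul_rpow hr.le (by positivity)]
      congr 1
      field_simp
    · have h2 : ¬ ‖r⁻¹ • w‖ < 1 := by
        rw [norm_smul, Real.norm_eq_abs, abs_of_pos (inv_pos.2 hr)]
        rw [inv_mul_lt_iff₀ hr]; simpa using hw
      rw [Set.indicator_of_notMem (by simpa using hw), Set.indicator_of_notMem (by simpa using h2)]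
      simp
  simp_rw [h]
  rw [integral_const_mul, Measure.integral_comp_inv_smul_of_nonneg _ _ hr.le]
  simp only [finrank_euclideanSpace, Fintype.card_fin, smul_eq_mul]
  rw [← mul_assoc, ← Real.rpow_natCast, ← Real.rpow_add hr]
  congr 2; ring

lemma normAlphaSq_le (d : ℕ) (hd : 1 ≤ d) (α : ℝ) (h1 : α < d) (h0 : 0 < α)
    (f H : EuclideanSpace ℝ (Fin d) → ℝ) (M N r : ℝ) (hr : 0 < r) (hM : 0 ≤ M)
    (hfM : ∀ z ∈ Q d, |f z| ≤ M) (hfH : ∀ z ∈ Q d, |f z| ≤ H z)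
    (hH : IntegrableOn H (Q d)) (hN : ∫ z in Q d, H z ≤ N) :
    normAlphaSq d α f ≤ N * (M * (r ^ ((d:ℝ) - α) * ∫ w, rieszK d α 1 w) + r ^ (-α) * N) := by
  set K := M * (r ^ ((d:ℝ) - α) * ∫ w, rieszK d α 1 w) + r ^ (-α) * N with hK
  have hI0 : 0 ≤ ∫ w, rieszK d α 1 w := integral_nonneg fun w => rieszK_nonneg _ _ _ _
  have hN0 : 0 ≤ N := le_trans (setIntegral_nonneg (measSet_Q d)
    fun z hz => (abs_nonneg _).trans (hfH z hz)) hN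
  have hK0 : 0 ≤ K := by positivity
  have inner : ∀ y ∈ Q d, (∫ z in Q d, |f y| * ‖y - z‖ ^ (-α) * |f z|) ≤ |f y| * K := by
    intro y hy
    have e1 : (∫ z in Q d, |f y| * ‖y - z‖ ^ (-α) * |f z|)
        = |f y| * ∫ z in Q d, ‖y - z‖ ^ (-α) * |f z| := by
      rw [← integral_const_mul]; simp_rw [mul_assoc]
    rw [e1]
    refine mul_le_mul_of_nonneg_left ?_ (abs_nonneg _)
    have hi1 : Integrable (fun z => rieszK d α r (y - z)) :=
      (rieszK_integrable d hd α h1 r).comp_sub_left y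
    calc (∫ z in Q d, ‖y - z‖ ^ (-α) * |f z|)
        ≤ ∫ z in Q d, (M * rieszK d α r (y - z) + r ^ (-α) * H z) := by
          refine integral_mono_of_nonneg (Filter.Eventually.of_forall fun z => by positivity)
            ((hi1.integrableOn.const_mul M).add (hH.const_mul _)) ?_
          refine (ae_restrict_iff' (measSet_Q d)).2 (Filter.Eventually.of_forall fun z hz => ?_)
          simp only
          have hHz : 0 ≤ H z := (abs_nonneg _).trans (hfH z hz)
          by_cases hw : ‖y - z‖ < r
          · have : rieszK d α r (y - z) = ‖y - z‖ ^ (-α) := by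
              unfold rieszK; rw [Set.indicator_of_mem (by simpa using hw)]
            rw [this]
            have := mul_le_mul_of_nonneg_left (hfM z hz) (by positivity : 0 ≤ ‖y - z‖ ^ (-α))
            have h3 : 0 ≤ r ^ (-α) * H z := by positivity
            linarith
          · push Not at hw
            have h2 : ‖y - z‖ ^ (-α) ≤ r ^ (-α) :=
              Real.rpow_le_rpow_of_nonpos hr hw (by linarith)
            have h3 := mul_le_mul h2 (hfH z hz) (abs_nonneg _) (by positivity)
            have h4 : 0 ≤ M * rieszK d α r (y - z) := mul_nonneg hM (rieszK_nonneg _ _ _ _)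
            linarith
      _ = M * (∫ z in Q d, rieszK d α r (y - z)) + r ^ (-α) * ∫ z in Q d, H z := by
          rw [integral_add (hi1.integrableOn.const_mul M) (hH.const_mul _),
            integral_const_mul, integral_const_mul]
      _ ≤ K := by
          have h5 : (∫ z in Q d, rieszK d α r (y - z)) ≤ r ^ ((d:ℝ) - α) * ∫ w, rieszK d α 1 w := by
            calc _ ≤ ∫ z, rieszK d α r (y - z) :=
                  setIntegral_le_integral hi1 (Filter.Eventually.of_forall fun z => rieszK_nonneg _ _ _ _)
              _ = ∫ z, rieszK d α r z := integral_sub_left_eq_self _ _ _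
              _ = _ := rieszK_integral d α r hr
          rw [hK]
          gcongr
  unfold normAlphaSq
  calc _ ≤ ∫ y in Q d, H y * K := by
        refine integral_mono_of_nonneg (Filter.Eventually.of_forall fun y => ?_)
            (hH.mul_const K) ?_
        · exact integral_nonneg fun z => by positivity
        · refine (ae_restrict_iff' (measSet_Q d)).2 (Filter.Eventually.of_forall fun z hz => ?_)
          exact (inner z hz).trans (mul_le_mul_of_nonneg_right (hfH z hz) hK0)
    _ = (∫ y in Q d, H y) * K := integral_mul_const _ _
    _ ≤ N * K := mul_le_mul_of_nonneg_right hN hK0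

lemma abs_prod_sub_prod_le {ι : Type*} [DecidableEq ι] (s : Finset ι) (p q : ι → ℝ) :
    |∏ i ∈ s, p i - ∏ i ∈ s, q i| ≤
      ∑ k ∈ s, ∏ i ∈ s, (if i = k then |p i - q i| else |p i| + |q i|) := by
  induction s using Finset.induction_on with
  | empty => simp
  | insert a s ha ih =>
    rw [Finset.prod_insert ha, Finset.prod_insert ha, Finset.sum_insert ha]
    have e1 : p a * ∏ i ∈ s, p i - q a * ∏ i ∈ s, q i
        = (p a - q a) * ∏ i ∈ s, p i + q a * (∏ i ∈ s, p i - ∏ i ∈ s, q i) := by ring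
    rw [e1]
    refine (abs_add_le _ _).trans (add_le_add ?_ ?_)
    · rw [Finset.prod_insert ha, if_pos rfl, abs_mul, Finset.abs_prod]
      refine mul_le_mul_of_nonneg_left (Finset.prod_le_prod (fun i _ => abs_nonneg _) ?_) (abs_nonneg _)
      intro i hi
      rw [if_neg (by rintro rfl; exact ha hi)]
      linarith [abs_nonneg (q i)]
    · rw [abs_mul]
      calc |q a| * |∏ i ∈ s, p i - ∏ i ∈ s, q i|
          ≤ (|p a| + |q a|) * ∑ k ∈ s, ∏ i ∈ s, (if i = k then |p i - q i| else |p i| + |q i|) := by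
            refine mul_le_mul (by linarith [abs_nonneg (p a)]) ih (abs_nonneg _) (by positivity)
        _ = _ := by
            rw [Finset.mul_sum]
            refine Finset.sum_congr rfl fun k hk => ?_
            rw [Finset.prod_insert ha, if_neg (by rintro rfl; exact ha hk)]

lemma Q_prod (d : ℕ) (h : Fin d → ℝ → ℝ) (hi : ∀ i, IntegrableOn (h i) (Set.Icc 0 1)) :
    IntegrableOn (fun y : EuclideanSpace ℝ (Fin d) => ∏ i, h i (y i)) (Q d) ∧
    ∫ y in Q d, ∏ i, h i (y i) = ∏ i, ∫ s in Set.Icc (0:ℝ) 1, h i s := by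
  have mp := (PiLp.volume_preserving_ofLp (Fin d))
  have hQ : Q d = (WithLp.ofLp : EuclideanSpace ℝ (Fin d) → (Fin d → ℝ)) ⁻¹' (Set.univ.pi fun _ => Set.Icc (0:ℝ) 1) := by
    ext x; simp [Q, Pi.le_def, forall_and]
  have me : MeasurableEmbedding (WithLp.ofLp : EuclideanSpace ℝ (Fin d) → (Fin d → ℝ)) :=
    (MeasurableEquiv.toLp 2 (Fin d → ℝ)).symm.measurableEmbedding
  have hr : (volume : Measure (Fin d → ℝ)).restrict (Set.univ.pi fun _ => Set.Icc (0:ℝ) 1)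
      = Measure.pi (fun _ => volume.restrict (Set.Icc (0:ℝ) 1)) := by
    rw [volume_pi, Measure.restrict_pi_pi]
  constructor
  · have := Integrable.fintype_prod (μ := fun _ : Fin d => volume.restrict (Set.Icc (0:ℝ) 1)) (f := h) hi
    rw [← hr] at this
    rw [hQ]
    exact (mp.integrableOn_comp_preimage me).2 this
  · rw [hQ, mp.setIntegral_preimage_emb me (fun y => ∏ i, h i (y i)), hr,
      integral_fintype_prod_eq_prod]

/-- dimension reduction -/
lemma normAlphaSq_prod_le (d : ℕ) (hd : 1 ≤ d) (α : ℝ) (h1 : α < d) (h0 : 0 < α)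
    (C : ℝ) (hC : 0 < C) : ∃ K : ℝ, 0 < K ∧ ∀ (p q : Fin d → ℝ → ℝ) (τ ε : ℝ), 0 < τ → 0 < ε →
      (∀ i, IntegrableOn (p i) (Set.Icc 0 1)) → (∀ i, IntegrableOn (q i) (Set.Icc 0 1)) →
      (∀ i, ∀ s ∈ Set.Icc (0:ℝ) 1, |p i s| ≤ C / τ) →
      (∀ i, ∀ s ∈ Set.Icc (0:ℝ) 1, |q i s| ≤ C / τ) →
      (∀ i, ∀ s ∈ Set.Icc (0:ℝ) 1, |p i s - q i s| ≤ C * ε / τ) →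
      (∀ i, ∫ s in Set.Icc (0:ℝ) 1, |p i s| ≤ C) →
      (∀ i, ∫ s in Set.Icc (0:ℝ) 1, |q i s| ≤ C) →
      (∀ i, ∫ s in Set.Icc (0:ℝ) 1, |p i s - q i s| ≤ C * ε) →
      normAlphaSq d α (fun y => ∏ i, p i (y i) - ∏ i, q i (y i)) ≤ K * (ε ^ 2 * τ ^ (-α)) := by
  set c0 := ∫ w, rieszK d α 1 w with hc0
  have hI0 : 0 ≤ c0 := integral_nonneg fun w => rieszK_nonneg _ _ _ _
  set m := (d:ℝ) * (2 * C) ^ d with hm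
  have hd0 : (0:ℝ) < d := by exact_mod_cast hd
  have hm0 : 0 < m := by positivity
  refine ⟨m * m * (c0 + 1), by positivity, ?_⟩
  intro p q τ ε hτ hε hpi hqi hp hq hpq hp1 hq1 hpq1
  let h : Fin d → Fin d → ℝ → ℝ := fun k i s => if i = k then |p i s - q i s| else |p i s| + |q i s|
  have hhi : ∀ k i, IntegrableOn (h k i) (Set.Icc 0 1) := by
    intro k i
    by_cases hik : i = k
    · simp only [h, if_pos hik]; exact ((hpi i).sub (hqi i)).abs
    · simp only [h, if_neg hik]; exact (hpi i).abs.add (hqi i).abs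
  have hh0 : ∀ k i s, 0 ≤ h k i s := by
    intro k i s
    simp only [h]; split_ifs <;> positivity
  have prodif : ∀ (k : Fin d) (a b : ℝ), 
      ∏ i : Fin d, (if i = k then a else b) = a * b ^ (d - 1) := by
    intro k a b
    rw [← Finset.mul_prod_erase Finset.univ _ (Finset.mem_univ k), if_pos rfl]
    congr 1
    rw [Finset.prod_congr rfl (g := fun _ => b)]
    · simp
    · intro i hi; rw [if_neg (Finset.ne_of_mem_erase hi)]
  have key := normAlphaSq_le d hd α h1 h0 (fun y => ∏ i, p i (y i) - ∏ i, q i (y i))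
    (fun y => ∑ k, ∏ i, h k i (y i)) (m * ε * τ ^ (-(d:ℝ))) (m * ε) τ hτ (by positivity) ?_ ?_ ?_ ?_
  · refine key.trans (le_of_eq ?_)
    have e1 : τ ^ (-(d:ℝ)) * τ ^ ((d:ℝ) - α) = τ ^ (-α) := by
      rw [← Real.rpow_add hτ]; congr 1; ring
    rw [← e1, ← hc0]
    ring
  · intro z hz
    refine (abs_prod_sub_prod_le _ _ _).trans ?_
    have : ∀ k ∈ (Finset.univ : Finset (Fin d)), ∏ i, (if i = k then |p i (z i) - q i (z i)| else |p i (z i)| + |q i (z i)|)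
        ≤ (2 * C) ^ d * ε * τ ^ (-(d:ℝ)) := by
      intro k _
      calc _ ≤ ∏ i : Fin d, (if i = k then C * ε / τ else 2 * C / τ) := by
            refine Finset.prod_le_prod (fun i _ => by split_ifs <;> positivity) fun i _ => ?_
            split_ifs
            · exact hpq i _ (hz i)
            · have := hp i _ (hz i); have := hq i _ (hz i)
              calc _ ≤ C / τ + C / τ := by linarith
                _ = _ := by ring
        _ ≤ (2 * C * ε / τ) * (2 * C / τ) ^ (d - 1) := by
            rw [prodif]
            gcongr
            linarith
        _ = (2 * C / τ) ^ (d - 1 + 1) * ε := by rw [pow_succ]; ring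
        _ = _ := by
            rw [Nat.sub_add_cancel hd, div_pow, Real.rpow_neg hτ.le, Real.rpow_natCast]
            ring
    refine (Finset.sum_le_sum this).trans (le_of_eq ?_)
    simp [hm]; ring
  · intro z hz
    exact abs_prod_sub_prod_le _ _ _
  · refine integrable_finsetSum _ fun k _ => (Q_prod d (h k) (hhi k)).1
  · rw [integral_finsetSum _ fun k _ => (Q_prod d (h k) (hhi k)).1]
    have : ∀ k ∈ (Finset.univ : Finset (Fin d)), (∫ y in Q d, ∏ i, h k i (y i)) ≤ (2 * C) ^ d * ε := by
      intro k _
      rw [(Q_prod d (h k) (hhi k)).2]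
      calc _ ≤ ∏ i : Fin d, (if i = k then C * ε else 2 * C) := by
            refine Finset.prod_le_prod (fun i _ => integral_nonneg (hh0 k i)) fun i _ => ?_
            by_cases hik : i = k
            · simp only [h, if_pos hik]; exact hpq1 i
            · simp only [h, if_neg hik]
              rw [integral_add (hpi i).abs (hqi i).abs]
              linarith [hp1 i, hq1 i]
        _ ≤ (2 * C * ε) * (2 * C) ^ (d - 1) := by
            rw [prodif]; gcongr; linarith
        _ = (2 * C) ^ (d - 1 + 1) * ε := by rw [pow_succ]; ring
        _ = _ := by rw [Nat.sub_add_cancel hd]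
    refine (Finset.sum_le_sum this).trans (le_of_eq ?_)
    simp [hm]; ring

def Main1D : Prop := ∃ C : ℝ, 0 < C ∧ ∀ n : ℕ, 2 ≤ n → ∀ τ : ℝ, 0 < τ → ∀ x ∈ Set.Icc (0:ℝ) 1,
    IntegrableOn (G (τ ^ 2) x) (Set.Icc 0 1) ∧ IntegrableOn (Gn n (τ ^ 2) x) (Set.Icc 0 1) ∧
    (∀ y ∈ Set.Icc (0:ℝ) 1, |G (τ ^ 2) x y| ≤ C / τ) ∧
    (∀ y ∈ Set.Icc (0:ℝ) 1, |Gn n (τ ^ 2) x y| ≤ C / τ) ∧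
    (∀ y ∈ Set.Icc (0:ℝ) 1, |G (τ ^ 2) x y - Gn n (τ ^ 2) x y| ≤ C / (n * τ ^ 2)) ∧
    (∫ y in Set.Icc (0:ℝ) 1, |G (τ ^ 2) x y| ≤ C) ∧
    (∫ y in Set.Icc (0:ℝ) 1, |Gn n (τ ^ 2) x y| ≤ C) ∧
    (∫ y in Set.Icc (0:ℝ) 1, |G (τ ^ 2) x y - Gn n (τ ^ 2) x y| ≤ C / (n * τ))

lemma majorant_int (α : ℝ) (h0 : 0 < α) (h2 : α < 2) (c : ℝ) (hc : 0 < c) :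
    IntegrableOn (fun t : ℝ => if t ≤ c then t ^ (-α/2) else c * t ^ (-α/2 - 1)) (Set.Ioi 0) ∧
    ∫ t in Set.Ioi (0:ℝ), (if t ≤ c then t ^ (-α/2) else c * t ^ (-α/2 - 1)) =
      (1 / (1 - α/2) + 1 / (α/2)) * c ^ (1 - α/2) := by
  have hu : Set.Ioi (0:ℝ) = Set.Ioc 0 c ∪ Set.Ioi c := (Set.Ioc_union_Ioi_eq_Ioi hc.le).symm
  have i1 : IntegrableOn (fun t : ℝ => t ^ (-α/2)) (Set.Ioc 0 c) := by
    have := (intervalIntegral.intervalIntegrable_rpow' (a := 0) (b := c) (r := -α/2) (by linarith))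
    rwa [intervalIntegrable_iff_integrableOn_Ioc_of_le hc.le] at this
  have i2 : IntegrableOn (fun t : ℝ => c * t ^ (-α/2 - 1)) (Set.Ioi c) :=
    (integrableOn_Ioi_rpow_of_lt (by linarith) hc).const_mul c
  have e1 : Set.EqOn (fun t : ℝ => if t ≤ c then t ^ (-α/2) else c * t ^ (-α/2 - 1)) (fun t : ℝ => t ^ (-α/2)) (Set.Ioc 0 c) := by
    intro t ht; simp only; rw [if_pos ht.2]
  have e2 : Set.EqOn (fun t : ℝ => if t ≤ c then t ^ (-α/2) else c * t ^ (-α/2 - 1)) (fun t : ℝ => c * t ^ (-α/2 - 1)) (Set.Ioi c) := by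
    intro t ht; simp only; rw [if_neg (not_le.2 ht)]
  have j1 := i1.congr_fun e1.symm measurableSet_Ioc
  have j2 := i2.congr_fun e2.symm measurableSet_Ioi
  rw [hu]
  refine ⟨j1.union j2, ?_⟩
  rw [setIntegral_union Set.Ioc_disjoint_Ioi_same measurableSet_Ioi j1 j2,
    setIntegral_congr_fun measurableSet_Ioc e1, setIntegral_congr_fun measurableSet_Ioi e2,
    ← intervalIntegral.integral_of_le hc.le, integral_rpow (Or.inl (by linarith)),
    integral_const_mul, integral_Ioi_rpow_of_lt (by linarith) hc]
  rw [Real.zero_rpow (by linarith)]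
  have : c * (-c ^ (-α / 2 - 1 + 1) / (-α / 2 - 1 + 1)) = 1 / (α/2) * c ^ (1 - α/2) := by
    have : c ^ (1 - α/2) = c * c ^ (-α / 2 - 1 + 1) := by
      nth_rewrite 2 [← Real.rpow_one c]
      rw [← Real.rpow_add hc]; congr 1; ring
    rw [this]
    have e : -α / 2 - 1 + 1 = -(α/2) := by ring
    rw [e]; field_simp
  rw [this]
  have e : -α / 2 + 1 = 1 - α / 2 := by ring
  rw [e]; ring

theorem final_of_main (hmain : Main1D) (d : ℕ) (hd : 1 ≤ d) (α : ℝ) (hα : α ∈ Set.Ioo (0 : ℝ) (min 2 (d : ℝ))) :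
    ∃ C : ℝ, 0 < C ∧ ∀ n : ℕ, 2 ≤ n →
      (∫ t in Set.Ioi (0 : ℝ),
          ⨆ x ∈ Q d, normAlphaSq d α (fun y => Gd d t x y - Gdn d n t x y))
        ≤ C * (n : ℝ) ^ (-(2 - α)) := by
  obtain ⟨C, hC, hm⟩ := hmain
  have h0 : 0 < α := hα.1
  have h2 : α < 2 := lt_of_lt_of_le hα.2 (min_le_left _ _)
  have h1 : α < d := lt_of_lt_of_le hα.2 (min_le_right _ _)
  obtain ⟨K, hK, hk⟩ := normAlphaSq_prod_le d hd α h1 h0 (2 * C) (by positivity)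
  have hpos : 0 < 1 / (1 - α/2) + 1 / (α/2) := by
    have : 0 < 1 - α/2 := by linarith
    positivity
  refine ⟨K * (1 / (1 - α/2) + 1 / (α/2)), by positivity, ?_⟩
  intro n hn
  have hn0 : (0:ℝ) < n := by positivity
  set c : ℝ := (n:ℝ) ^ (-2:ℝ) with hc
  have hc0 : 0 < c := by positivity
  obtain ⟨mi, me⟩ := majorant_int α h0 h2 c hc0
  have bound : ∀ t ∈ Set.Ioi (0:ℝ), ∀ x ∈ Q d,
      normAlphaSq d α (fun y => Gd d t x y - Gdn d n t x y) ≤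
        K * (if t ≤ c then t ^ (-α/2) else c * t ^ (-α/2 - 1)) := by
    intro t ht x hx
    have ht : 0 < t := ht
    set τ := Real.sqrt t with hτ
    have hτ0 : 0 < τ := Real.sqrt_pos.2 ht
    have hsq : τ ^ 2 = t := Real.sq_sqrt ht.le
    have htau : τ ^ (-α) = t ^ (-α/2) := by
      rw [hτ, Real.sqrt_eq_rpow, ← Real.rpow_mul ht.le]; congr 1; ring
    have hmx := fun i => hm n hn τ hτ0 (x i) (hx i)
    rw [hsq] at hmx
    unfold Gd Gdn
    by_cases hcase : t ≤ c
    · rw [if_pos hcase]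
      have := hk (fun i => G t (x i)) (fun i => Gn n t (x i)) τ 1 hτ0 one_pos
        (fun i => (hmx i).1) (fun i => (hmx i).2.1)
        (fun i s hs => ((hmx i).2.2.1 s hs).trans (by gcongr; linarith))
        (fun i s hs => ((hmx i).2.2.2.1 s hs).trans (by gcongr; linarith))
        (fun i s hs => by
          refine (abs_sub _ _).trans ((add_le_add ((hmx i).2.2.1 s hs) ((hmx i).2.2.2.1 s hs)).trans
            (le_of_eq (by ring))))
        (fun i => (hmx i).2.2.2.2.2.1.trans (by linarith))
        (fun i => (hmx i).2.2.2.2.2.2.1.trans (by linarith))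
        (fun i => by
          have e1 := (hmx i).2.2.2.2.2.1
          have e2 := (hmx i).2.2.2.2.2.2.1
          calc _ ≤ ∫ s in Set.Icc (0:ℝ) 1, (|G t (x i) s| + |Gn n t (x i) s|) := by
                refine integral_mono_of_nonneg (Filter.Eventually.of_forall fun s => abs_nonneg _)
                  ((hmx i).1.abs.add (hmx i).2.1.abs) (Filter.Eventually.of_forall fun s => abs_sub _ _)
            _ = _ := integral_add (hmx i).1.abs (hmx i).2.1.abs
            _ ≤ _ := by linarith)
      simpa [htau] using this
    · rw [if_neg hcase]
      have := hk (fun i => G t (x i)) (fun i => Gn n t (x i)) τ (1 / (n * τ)) hτ0 (by positivity)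
        (fun i => (hmx i).1) (fun i => (hmx i).2.1)
        (fun i s hs => ((hmx i).2.2.1 s hs).trans (by gcongr; linarith))
        (fun i s hs => ((hmx i).2.2.2.1 s hs).trans (by gcongr; linarith))
        (fun i s hs => ((hmx i).2.2.2.2.1 s hs).trans (by
          rw [← hsq]
          have : 2 * C * (1 / (n * τ)) / τ = 2 * C / (n * τ ^ 2) := by field_simp
          rw [this]; gcongr; linarith))
        (fun i => (hmx i).2.2.2.2.2.1.trans (by linarith))
        (fun i => (hmx i).2.2.2.2.2.2.1.trans (by linarith))
        (fun i => (hmx i).2.2.2.2.2.2.2.trans (by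
          have : 2 * C * (1 / (n * τ)) = 2 * C / (n * τ) := by field_simp
          rw [this]; gcongr; linarith))
      refine this.trans (le_of_eq ?_)
      have e3 : (1 / (n * τ)) ^ 2 = c * t⁻¹ := by
        rw [hc, Real.rpow_neg hn0.le, ← hsq, div_pow, mul_pow]; norm_num
        field_simp
      rw [e3, htau, Real.rpow_sub ht, Real.rpow_one]; ring
  have nn : ∀ t x, 0 ≤ normAlphaSq d α (fun y => Gd d t x y - Gdn d n t x y) := by
    intro t x
    unfold normAlphaSq
    exact integral_nonneg fun y => integral_nonneg fun z => by positivity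
  calc _ ≤ ∫ t in Set.Ioi (0:ℝ), K * (if t ≤ c then t ^ (-α/2) else c * t ^ (-α/2 - 1)) := by
        refine integral_mono_of_nonneg (Filter.Eventually.of_forall fun t => ?_) (mi.const_mul K) ?_
        · exact Real.iSup_nonneg fun x => Real.iSup_nonneg fun _ => nn t x
        · refine (ae_restrict_iff' measurableSet_Ioi).2 (Filter.Eventually.of_forall fun t ht => ?_)
          have ht' : 0 < t := ht
          have hb : 0 ≤ K * (if t ≤ c then t ^ (-α/2) else c * t ^ (-α/2 - 1)) := by
            split_ifs <;> positivity
          exact Real.iSup_le (fun x => Real.iSup_le (fun hx => bound t ht x hx) hb) hb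
    _ = K * (1 / (1 - α/2) + 1 / (α/2)) * (n : ℝ) ^ (-(2 - α)) := by
        rw [integral_const_mul, me, hc, ← Real.rpow_mul hn0.le, mul_assoc]
        congr 3; ring

lemma poly_exp : ∃ P : ℝ, 1 ≤ P ∧ ∀ r : ℝ, 0 ≤ r → ∀ k : ℕ, k ≤ 5 →
    r ^ k * Real.exp (-(4/9) * r ^ 2) ≤ P * Real.exp (-(2/9) * r ^ 2) := by
  refine ⟨1 + Nat.factorial 5 * (9/2) ^ 5, by norm_num [Nat.factorial], ?_⟩
  intro r hr k hk
  have h1 : r ^ k ≤ 1 + (r ^ 2) ^ 5 := by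
    rcases le_total r 1 with h | h
    · have : r ^ k ≤ 1 := pow_le_one₀ hr h
      have : 0 ≤ (r^2)^5 := by positivity
      linarith
    · have : r ^ k ≤ r ^ 10 := pow_le_pow_right₀ h (by omega)
      rw [← pow_mul]; norm_num; linarith
  have h2 : ((2/9) * r ^ 2) ^ 5 / Nat.factorial 5 ≤ Real.exp ((2/9) * r ^ 2) :=
    Real.pow_div_factorial_le_exp _ (by positivity) 5
  have h3 : 1 ≤ Real.exp ((2/9) * r ^ 2) := Real.one_le_exp (by positivity)
  have h4 : r ^ k ≤ (1 + Nat.factorial 5 * (9/2) ^ 5) * Real.exp ((2/9) * r ^ 2) := by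
    have : (r ^ 2) ^ 5 = (9/2) ^ 5 * Nat.factorial 5 * (((2/9) * r ^ 2) ^ 5 / Nat.factorial 5) := by
      norm_num [Nat.factorial]; ring
    have h5 : (r ^ 2) ^ 5 ≤ (9/2) ^ 5 * Nat.factorial 5 * Real.exp ((2/9) * r ^ 2) := by
      rw [this]; gcongr
    nlinarith
  calc _ ≤ ((1 + Nat.factorial 5 * (9/2) ^ 5) * Real.exp ((2/9) * r ^ 2)) * Real.exp (-(4/9) * r ^ 2) := by
        gcongr
    _ = _ := by
        rw [mul_assoc, ← Real.exp_add]; congr 2; ring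

lemma gaussN (c : ℝ) (hc : 0 < c) (τ : ℝ) (hτ : 0 < τ) :
    Summable (fun j : ℕ => Real.exp (-c * (((j:ℝ) + 1) * τ) ^ 2)) ∧
    ∑' j : ℕ, Real.exp (-c * (((j:ℝ) + 1) * τ) ^ 2) ≤ (Real.sqrt (Real.pi / c) / 2) / τ := by
  have key : ∀ N : ℕ, ∑ j ∈ Finset.range N, Real.exp (-c * (((j:ℝ) + 1) * τ) ^ 2)
      ≤ (Real.sqrt (Real.pi / c) / 2) / τ := by
    intro N
    have hanti : AntitoneOn (fun s : ℝ => Real.exp (-(c * τ ^ 2) * s ^ 2)) (Set.Icc (0:ℝ) (0 + N)) := by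
      intro a ha b hb hab
      apply Real.exp_le_exp.2
      have : a ^ 2 ≤ b ^ 2 := by have := ha.1; gcongr
      have h2 : 0 ≤ c * τ ^ 2 := by positivity
      nlinarith
    have h := hanti.sum_le_integral
    have hcp : 0 < c * τ ^ 2 := by positivity
    have h3 : ∫ x in (0:ℝ)..(0 + N), Real.exp (-(c * τ ^ 2) * x ^ 2)
        ≤ ∫ x in Set.Ioi (0:ℝ), Real.exp (-(c * τ ^ 2) * x ^ 2) := by
      rw [intervalIntegral.integral_of_le (by positivity)]
      refine setIntegral_mono_set (integrable_exp_neg_mul_sq hcp).integrableOn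
        (Filter.Eventually.of_forall fun x => (Real.exp_pos _).le)
        (Set.Ioc_subset_Ioi_self.eventuallyLE)
    rw [integral_gaussian_Ioi] at h3
    have h4 : Real.sqrt (Real.pi / (c * τ ^ 2)) / 2 = (Real.sqrt (Real.pi / c) / 2) / τ := by
      rw [show Real.pi / (c * τ^2) = (Real.pi / c) / τ ^ 2 by field_simp, Real.sqrt_div' _ (by positivity),
        Real.sqrt_sq hτ.le]
      ring
    rw [h4] at h3
    refine le_trans (le_of_eq ?_) (h.trans h3)
    refine Finset.sum_congr rfl fun j _ => ?_
    congr 1; push_cast; ring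
  have hs := summable_of_sum_range_le (fun j => (Real.exp_pos _).le) key
  exact ⟨hs, Real.tsum_le_of_sum_range_le (fun j => (Real.exp_pos _).le) key⟩

/-- Gaussian weight without zero mode. -/
noncomputable def g0 (c τ : ℝ) (j : ℤ) : ℝ := if j = 0 then 0 else Real.exp (-c * ((j:ℝ) * τ) ^ 2)
/-- Gaussian weight. -/
noncomputable def gg (c τ : ℝ) (j : ℤ) : ℝ := Real.exp (-c * ((j:ℝ) * τ) ^ 2)

lemma gaussZ0 (c : ℝ) (hc : 0 < c) (τ : ℝ) (hτ : 0 < τ) :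
    Summable (g0 c τ) ∧ ∑' j, g0 c τ j ≤ Real.sqrt (Real.pi / c) / τ := by
  obtain ⟨h1, h2⟩ := gaussN c hc τ hτ
  have e1 : (fun j : ℕ => g0 c τ ((j:ℤ) + 1)) = fun j : ℕ => Real.exp (-c * (((j:ℝ) + 1) * τ) ^ 2) := by
    funext j
    have : ((j:ℤ) + 1) ≠ 0 := by omega
    simp only [g0, if_neg this]; push_cast; rfl
  have e2 : (fun j : ℕ => g0 c τ (-((j:ℤ) + 1))) = fun j : ℕ => Real.exp (-c * (((j:ℝ) + 1) * τ) ^ 2) := by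
    funext j
    have : (-((j:ℤ) + 1)) ≠ 0 := by omega
    simp only [g0, if_neg this]; push_cast; congr 1; ring
  have s1 : Summable (fun j : ℕ => g0 c τ ((j:ℤ) + 1)) := by rw [e1]; exact h1
  have s2 : Summable (fun j : ℕ => g0 c τ (-((j:ℤ) + 1))) := by rw [e2]; exact h1
  refine ⟨Summable.of_add_one_of_neg_add_one s1 s2, ?_⟩
  rw [tsum_of_add_one_of_neg_add_one s1 s2, e1, e2]
  have : g0 c τ 0 = 0 := by simp [g0]
  rw [this]
  calc _ ≤ (Real.sqrt (Real.pi / c) / 2) / τ + 0 + (Real.sqrt (Real.pi / c) / 2) / τ := by gcongr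
    _ = _ := by ring

lemma gg_eq (c τ : ℝ) : gg c τ = fun j => g0 c τ j + (Pi.single (0:ℤ) (1:ℝ) : ℤ → ℝ) j := by
  funext j
  by_cases hj : j = 0
  · subst hj; simp [gg, g0]
  · simp [gg, g0, hj]

lemma gaussZ (c : ℝ) (hc : 0 < c) (τ : ℝ) (hτ : 0 < τ) :
    Summable (gg c τ) ∧ (τ ≤ 1 → ∑' j, gg c τ j ≤ (Real.sqrt (Real.pi / c) + 1) / τ) := by
  obtain ⟨h1, h2⟩ := gaussZ0 c hc τ hτ
  have h3 : HasSum (Pi.single (0:ℤ) (1:ℝ) : ℤ → ℝ) 1 := hasSum_pi_single 0 1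
  rw [gg_eq]
  refine ⟨h1.add h3.summable, fun hτ1 => ?_⟩
  rw [h1.tsum_add h3.summable, h3.tsum_eq, add_div]
  gcongr
  rw [le_div_iff₀ hτ]; linarith

/-- Exponentials -/
noncomputable def Ez (u : ℝ) (j : ℤ) : ℂ := Complex.exp (Complex.I * ((Real.pi * u * j : ℝ) : ℂ))

lemma Ez_norm (u : ℝ) (j : ℤ) : ‖Ez u j‖ = 1 := by
  unfold Ez; rw [mul_comm]; exact Complex.norm_exp_ofReal_mul_I _

lemma Ez_add (u : ℝ) (j k : ℤ) : Ez u (j + k) = Ez u j * Ez u k := by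
  unfold Ez; rw [← Complex.exp_add]; congr 1; push_cast; ring

lemma Ez_add' (u v : ℝ) (j : ℤ) : Ez (u + v) j = Ez u j * Ez v j := by
  unfold Ez; rw [← Complex.exp_add]; congr 1; push_cast; ring

lemma Ez_re (u : ℝ) (j : ℤ) : (Ez u j).re = Real.cos (Real.pi * u * j) := by
  unfold Ez; rw [mul_comm, Complex.exp_ofReal_mul_I_re]

noncomputable def om (u : ℝ) : ℝ := Real.sin (Real.pi * u / 2) ^ 2

lemma om_nonneg (u : ℝ) : 0 ≤ om u := sq_nonneg _
lemma om_le_one (u : ℝ) : om u ≤ 1 := Real.sin_sq_le_one _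

lemma Ez_om (u : ℝ) : 2 - Ez u 1 - Ez u (-1) = ((4 * om u : ℝ) : ℂ) := by
  have h : Ez u 1 + Ez u (-1) = ((2 * Real.cos (Real.pi * u) : ℝ) : ℂ) := by
    unfold Ez
    have := Complex.two_cos ((Real.pi * u : ℝ) : ℂ)
    push_cast at this ⊢
    rw [this]
    congr 2 <;> ring
  have h2 : Real.cos (Real.pi * u) = 1 - 2 * om u := by
    unfold om
    have := Real.cos_two_mul (Real.pi * u / 2)
    rw [show 2 * (Real.pi * u / 2) = Real.pi * u by ring] at this
    have h3 := Real.sin_sq_add_cos_sq (Real.pi * u / 2)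
    linarith
  rw [sub_sub, h, h2]; push_cast; ring

/-- second difference -/
noncomputable def d2 (c : ℤ → ℂ) (j : ℤ) : ℂ := 2 * c j - c (j - 1) - c (j + 1)

lemma summable_mul_Ez (c : ℤ → ℂ) (hc : Summable fun j => ‖c j‖) (u : ℝ) :
    Summable fun j => c j * Ez u j := by
  refine Summable.of_norm ?_
  simpa [Ez_norm] using hc

lemma abel_tsum (c : ℤ → ℂ) (hc : Summable fun j => ‖c j‖) (u : ℝ) :
    ((4 * om u : ℝ) : ℂ) * ∑' j, c j * Ez u j = ∑' j, d2 c j * Ez u j := by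
  have hs := summable_mul_Ez c hc u
  have hc1 : Summable fun j : ℤ => c (j - 1) * Ez u j := by
    refine summable_mul_Ez (fun j => c (j - 1)) ?_ u
    exact (Equiv.subRight (1:ℤ)).summable_iff (f := fun j => ‖c j‖) |>.2 hc
  have hc2 : Summable fun j : ℤ => c (j + 1) * Ez u j := by
    refine summable_mul_Ez (fun j => c (j + 1)) ?_ u
    exact (Equiv.addRight (1:ℤ)).summable_iff (f := fun j => ‖c j‖) |>.2 hc
  have t1 : ∑' j : ℤ, c (j - 1) * Ez u j = Ez u 1 * ∑' j, c j * Ez u j := by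
    rw [← (Equiv.addRight (1:ℤ)).tsum_eq, ← tsum_mul_left]
    refine tsum_congr fun j => ?_
    simp [Ez_add]; ring
  have t2 : ∑' j : ℤ, c (j + 1) * Ez u j = Ez u (-1) * ∑' j, c j * Ez u j := by
    rw [← (Equiv.addRight (-1:ℤ)).tsum_eq, ← tsum_mul_left]
    refine tsum_congr fun j => ?_
    simp [Ez_add]; ring
  have : ∑' j, d2 c j * Ez u j = 2 * (∑' j, c j * Ez u j) - ∑' j : ℤ, c (j - 1) * Ez u j - ∑' j : ℤ, c (j + 1) * Ez u j := by
    rw [← tsum_mul_left, ← (hs.mul_left 2).tsum_sub hc1, ← ((hs.mul_left 2).sub hc1).tsum_sub hc2]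
    refine tsum_congr fun j => ?_
    unfold d2; ring
  rw [this, t1, t2, ← Ez_om]; ring

lemma sum_Ico_shift (f : ℤ → ℂ) (n : ℕ) :
    ∑ j ∈ Finset.Ico (-(n:ℤ)) n, (f (j + 1) - f j) = f n - f (-n) := by
  induction n with
  | zero => simp
  | succ n ih =>
    have : Finset.Ico (-((n+1 : ℕ):ℤ)) ((n+1 : ℕ):ℤ) =
        insert (-(n:ℤ) - 1) (insert (n:ℤ) (Finset.Ico (-(n:ℤ)) n)) := by
      ext j; simp; omega
    rw [this, Finset.sum_insert (by simp), Finset.sum_insert (by simp), ih]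
    push_cast
    rw [show -(n:ℤ) - 1 + 1 = -n by ring, show -((n:ℤ) + 1) = -(n:ℤ) - 1 by ring]
    ring

lemma abel_fin (c : ℤ → ℂ) (n : ℕ) (hc : ∀ j, c (j + 2 * n) = c j) (u : ℝ)
    (hu : ∀ j, Ez u (j + 2 * n) = Ez u j) :
    ((4 * om u : ℝ) : ℂ) * ∑ j ∈ Finset.Ico (-(n:ℤ)) n, c j * Ez u j
      = ∑ j ∈ Finset.Ico (-(n:ℤ)) n, d2 c j * Ez u j := by
  have h1 := sum_Ico_shift (fun j => c (j - 1) * Ez u j) n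
  have h2 := sum_Ico_shift (fun j => c j * Ez u (j - 1)) n
  have z1 : c ((n:ℤ) - 1) * Ez u n - c (-(n:ℤ) - 1) * Ez u (-n) = 0 := by
    rw [← hc (-(n:ℤ) - 1), ← hu (-n), show -(n:ℤ) - 1 + 2 * n = n - 1 by ring,
      show -(n:ℤ) + 2 * n = n by ring]; ring
  have z2 : c (n:ℤ) * Ez u (n - 1) - c (-(n:ℤ)) * Ez u (-n - 1) = 0 := by
    rw [← hc (-(n:ℤ)), ← hu (-n - 1), show -(n:ℤ) - 1 + 2 * n = n - 1 by ring,
      show -(n:ℤ) + 2 * n = n by ring]; ring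
  rw [z1] at h1
  rw [z2] at h2
  have h3 : ((4 * om u : ℝ) : ℂ) * ∑ j ∈ Finset.Ico (-(n:ℤ)) n, c j * Ez u j
      - ∑ j ∈ Finset.Ico (-(n:ℤ)) n, d2 c j * Ez u j =
      - ∑ j ∈ Finset.Ico (-(n:ℤ)) n, (c (j + 1 - 1) * Ez u (j + 1) - c (j - 1) * Ez u j)
      + ∑ j ∈ Finset.Ico (-(n:ℤ)) n, (c (j + 1) * Ez u (j + 1 - 1) - c j * Ez u (j - 1)) := by
    rw [← Ez_om, Finset.mul_sum, ← Finset.sum_sub_distrib, ← Finset.sum_neg_distrib, ← Finset.sum_add_distrib]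
    refine Finset.sum_congr rfl fun j _ => ?_
    unfold d2
    rw [add_sub_cancel_right, Ez_add u j 1, sub_eq_add_neg j 1, Ez_add u j (-1)]
    ring
  rw [h1, h2] at h3
  have : ((4 * om u : ℝ) : ℂ) * ∑ j ∈ Finset.Ico (-(n:ℤ)) n, c j * Ez u j
      - ∑ j ∈ Finset.Ico (-(n:ℤ)) n, d2 c j * Ez u j = 0 := by rw [h3]; ring
  exact sub_eq_zero.1 this

lemma second_diff {F : Type*} [NormedAddCommGroup F] [NormedSpace ℝ F] (f f' f'' : ℝ → F) (s B : ℝ)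
    (h1 : ∀ x, HasDerivAt f (f' x) x) (h2 : ∀ x, HasDerivAt f' (f'' x) x)
    (hB : ∀ x ∈ Set.Icc (s - 1) (s + 1), ‖f'' x‖ ≤ B) :
    ‖(f (s + 1) - f s) - (f s - f (s - 1))‖ ≤ B := by
  have hlip : ∀ x ∈ Set.Icc (s-1) s, ‖f' (x + 1) - f' x‖ ≤ B := by
    intro x hx
    have := (convex_Icc (s-1) (s+1)).norm_image_sub_le_of_norm_hasDerivWithin_le
      (f := f') (f' := f'') (C := B) (fun y _ => (h2 y).hasDerivWithinAt) hB
      (x := x) (y := x + 1) ⟨hx.1, by linarith [hx.2]⟩ ⟨by linarith [hx.1], by linarith [hx.2]⟩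
    simpa using this
  have := (convex_Icc (s-1) s).norm_image_sub_le_of_norm_hasDerivWithin_le
      (f := fun x => f (x + 1) - f x) (f' := fun x => f' (x + 1) - f' x) (C := B)
      (fun y _ => (((h1 (y+1)).comp_add_const y 1).sub (h1 y)).hasDerivWithinAt) hlip
      (x := s - 1) (y := s) ⟨le_refl _, by linarith⟩ ⟨by linarith, le_refl _⟩
  simpa using this

lemma gauss_shift (τ s : ℝ) (j : ℤ) (hτ : 0 < τ) (hτ1 : τ ≤ 1)
    (hs : s ∈ Set.Icc ((j:ℝ) - 1) (j + 1)) :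
    Real.exp (-(2/9) * (|s| * τ) ^ 2) ≤ Real.exp (2/9) * gg (1/9) τ j := by
  unfold gg
  rw [← Real.exp_add]
  apply Real.exp_le_exp.2
  have h1 : (j:ℝ) ^ 2 ≤ 2 * s ^ 2 + 2 := by nlinarith [hs.1, hs.2, sq_nonneg (2 * s - j), mul_nonneg (sub_nonneg.2 hs.1) (sub_nonneg.2 hs.2)]
  have h2 : τ ^ 2 ≤ 1 := by nlinarith
  have h3 : 0 ≤ τ ^ 2 := sq_nonneg _
  rw [mul_pow, mul_pow, sq_abs]
  nlinarith

noncomputable def aR (τ s : ℝ) : ℝ := Real.exp (-(Real.pi ^ 2 * (s * τ) ^ 2))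
noncomputable def aR1 (τ s : ℝ) : ℝ := -(2 * Real.pi ^ 2 * τ ^ 2 * s) * aR τ s
noncomputable def aR2 (τ s : ℝ) : ℝ :=
  (4 * Real.pi ^ 4 * τ ^ 4 * s ^ 2 - 2 * Real.pi ^ 2 * τ ^ 2) * aR τ s

lemma aR_pos (τ s : ℝ) : 0 < aR τ s := Real.exp_pos _

lemma aR_deriv (τ s : ℝ) : HasDerivAt (aR τ) (aR1 τ s) s := by
  unfold aR1 aR
  have h : HasDerivAt (fun s : ℝ => -(Real.pi ^ 2 * (s * τ) ^ 2)) (-(Real.pi ^ 2 * (2 * (s * τ) * τ))) s := by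
    have := ((((hasDerivAt_id s).mul_const τ).pow 2).const_mul (Real.pi ^ 2)).neg
    refine HasDerivAt.congr_deriv this ?_
    simp
  refine HasDerivAt.congr_deriv h.exp ?_
  ring

lemma aR1_deriv (τ s : ℝ) : HasDerivAt (aR1 τ) (aR2 τ s) s := by
  have h : HasDerivAt (fun s : ℝ => -(2 * Real.pi ^ 2 * τ ^ 2 * s)) (-(2 * Real.pi ^ 2 * τ ^ 2)) s := by
    refine HasDerivAt.congr_deriv ((hasDerivAt_id s).const_mul (2 * Real.pi ^ 2 * τ ^ 2)).neg ?_
    simp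
  refine HasDerivAt.congr_deriv (h.mul (aR_deriv τ s)) ?_
  unfold aR2 aR1; ring

noncomputable def wt (τ s : ℝ) : ℝ := Real.exp (-(2/9) * (|s| * τ) ^ 2)
lemma wt_pos (τ s : ℝ) : 0 < wt τ s := Real.exp_pos _

lemma aR_le (τ s : ℝ) : aR τ s ≤ Real.exp (-(4/9) * (|s| * τ) ^ 2) := by
  unfold aR
  apply Real.exp_le_exp.2
  rw [mul_pow, mul_pow, sq_abs]
  have : 4/9 ≤ Real.pi ^ 2 := by nlinarith [Real.pi_gt_three]
  have h2 : 0 ≤ s ^ 2 * τ ^ 2 := by positivity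
  nlinarith

/-- bounds on `a` and its derivatives with extra powers of `|s|τ` -/
lemma aR_bounds : ∃ C : ℝ, 0 < C ∧ ∀ τ s : ℝ, 0 < τ →
    aR τ s ≤ C * wt τ s ∧ (|s| * τ) * aR τ s ≤ C * wt τ s ∧
    |aR1 τ s| ≤ C * τ * wt τ s ∧ |aR2 τ s| ≤ C * τ ^ 2 * wt τ s ∧
    (|s| * τ) * |aR2 τ s| ≤ C * τ ^ 2 * wt τ s := by
  obtain ⟨P, hP1, hP⟩ := poly_exp
  have hpi := Real.pi_pos
  refine ⟨P * (4 * Real.pi ^ 4 + 2 * Real.pi ^ 2 + 1), by positivity, ?_⟩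
  intro τ s hτ
  set r := |s| * τ with hr
  have hr0 : 0 ≤ r := by positivity
  have mono : ∀ k : ℕ, k ≤ 5 → r ^ k * aR τ s ≤ P * wt τ s := by
    intro k hk
    exact (mul_le_mul_of_nonneg_left (aR_le τ s) (by positivity)).trans (hP r hr0 k hk)
  have m0 := mono 0 (by norm_num)
  have m1 := mono 1 (by norm_num)
  have m2 := mono 2 (by norm_num)
  have m3 := mono 3 (by norm_num)
  simp only [pow_zero, one_mul, pow_one] at m0 m1
  have hw := wt_pos τ s
  have ha := aR_pos τ s
  have hPw : 0 ≤ P * wt τ s := by positivity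
  have e1 : |aR1 τ s| = 2 * Real.pi ^ 2 * τ * (r * aR τ s) := by
    unfold aR1
    rw [abs_mul, abs_of_pos ha, abs_neg, abs_mul, abs_of_pos (by positivity : 0 < 2 * Real.pi ^ 2 * τ ^ 2), hr]
    ring
  have e2 : |aR2 τ s| ≤ τ ^ 2 * (4 * Real.pi ^ 4 * (r ^ 2 * aR τ s) + 2 * Real.pi ^ 2 * aR τ s) := by
    unfold aR2
    rw [abs_mul, abs_of_pos ha]
    have : |4 * Real.pi ^ 4 * τ ^ 4 * s ^ 2 - 2 * Real.pi ^ 2 * τ ^ 2| ≤ 4 * Real.pi ^ 4 * τ ^ 4 * s ^ 2 + 2 * Real.pi ^ 2 * τ ^ 2 := by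
      refine (abs_sub _ _).trans (le_of_eq ?_)
      rw [abs_of_nonneg (by positivity), abs_of_nonneg (by positivity)]
    refine (mul_le_mul_of_nonneg_right this ha.le).trans (le_of_eq ?_)
    rw [hr, mul_pow, sq_abs]; ring
  have hp4 : 0 ≤ Real.pi ^ 4 * (P * wt τ s) := by positivity
  have hp2 : 0 ≤ Real.pi ^ 2 * (P * wt τ s) := by positivity
  refine ⟨by nlinarith, by nlinarith, ?_, ?_, ?_⟩
  · rw [e1]
    calc _ ≤ 2 * Real.pi ^ 2 * τ * (P * wt τ s) := by gcongr
      _ ≤ _ := by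
        have : 0 ≤ τ * (4 * (Real.pi ^ 4 * (P * wt τ s)) + P * wt τ s) := by positivity
        nlinarith
  · refine e2.trans ?_
    calc _ ≤ τ ^ 2 * (4 * Real.pi ^ 4 * (P * wt τ s) + 2 * Real.pi ^ 2 * (P * wt τ s)) := by gcongr
      _ ≤ _ := by
        have : 0 ≤ τ ^ 2 * (P * wt τ s) := by positivity
        nlinarith
  · calc _ ≤ r * (τ ^ 2 * (4 * Real.pi ^ 4 * (r ^ 2 * aR τ s) + 2 * Real.pi ^ 2 * aR τ s)) := by gcongr
      _ = τ ^ 2 * (4 * Real.pi ^ 4 * (r ^ 3 * aR τ s) + 2 * Real.pi ^ 2 * (r * aR τ s)) := by ring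
      _ ≤ τ ^ 2 * (4 * Real.pi ^ 4 * (P * wt τ s) + 2 * Real.pi ^ 2 * (P * wt τ s)) := by gcongr
      _ ≤ _ := by
        have : 0 ≤ τ ^ 2 * (P * wt τ s) := by positivity
        nlinarith

/-- coefficient sequences -/
noncomputable def aZ (τ : ℝ) (j : ℤ) : ℂ := (aR τ j : ℂ)

lemma d2_of_fun (f f' f'' : ℝ → ℂ) (j : ℤ) (B : ℝ)
    (h1 : ∀ x, HasDerivAt f (f' x) x) (h2 : ∀ x, HasDerivAt f' (f'' x) x)
    (hB : ∀ x ∈ Set.Icc ((j:ℝ) - 1) (j + 1), ‖f'' x‖ ≤ B) :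
    ‖d2 (fun j : ℤ => f (j:ℝ)) j‖ ≤ B := by
  have := second_diff f f' f'' (j:ℝ) B h1 h2 hB
  unfold d2
  rw [← norm_neg]
  refine le_of_eq_of_le ?_ this
  apply congrArg
  push_cast; ring

lemma d2a_bound : ∃ C : ℝ, 0 < C ∧ ∀ τ : ℝ, 0 < τ → τ ≤ 1 → ∀ j : ℤ,
    ‖d2 (aZ τ) j‖ ≤ C * τ ^ 2 * gg (1/9) τ j := by
  obtain ⟨C, hC, h⟩ := aR_bounds
  refine ⟨C * Real.exp (2/9), by positivity, fun τ hτ hτ1 j => ?_⟩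
  refine d2_of_fun (fun s => (aR τ s : ℂ)) (fun s => (aR1 τ s : ℂ)) (fun s => (aR2 τ s : ℂ)) j _
    (fun x => (aR_deriv τ x).ofReal_comp) (fun x => (aR1_deriv τ x).ofReal_comp) ?_
  intro x hx
  rw [Complex.norm_real, Real.norm_eq_abs]
  refine (h τ x hτ).2.2.2.1.trans ?_
  calc _ ≤ C * τ ^ 2 * (Real.exp (2/9) * gg (1/9) τ j) := by
        gcongr; exact gauss_shift τ x j hτ hτ1 hx
    _ = _ := by ring

/-- outside `[-n, n)` -/
lemma d2a_out : ∃ C : ℝ, 0 < C ∧ ∀ τ : ℝ, 0 < τ → τ ≤ 1 → ∀ n : ℕ, 2 ≤ n → ∀ j : ℤ,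
    (n:ℤ) ≤ |j| → ‖d2 (aZ τ) j‖ ≤ C * (τ / n) * gg (1/9) τ j := by
  obtain ⟨C, hC, h⟩ := aR_bounds
  refine ⟨2 * C * Real.exp (2/9), by positivity, fun τ hτ hτ1 n hn j hj => ?_⟩
  have hn0 : (0:ℝ) < n := by positivity
  have hn2 : (2:ℝ) ≤ n := by exact_mod_cast hn
  refine d2_of_fun (fun s => (aR τ s : ℂ)) (fun s => (aR1 τ s : ℂ)) (fun s => (aR2 τ s : ℂ)) j _
    (fun x => (aR_deriv τ x).ofReal_comp) (fun x => (aR1_deriv τ x).ofReal_comp) ?_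
  intro x hx
  rw [Complex.norm_real, Real.norm_eq_abs]
  have hj' : (n:ℝ) ≤ |(j:ℝ)| := by exact_mod_cast hj
  have hx1 : |(j:ℝ) - x| ≤ 1 := abs_le.2 ⟨by linarith [hx.2], by linarith [hx.1]⟩
  have hx2 : (n:ℝ) ≤ 2 * |x| := by
    have := abs_sub_abs_le_abs_sub (j:ℝ) x
    linarith
  have := (h τ x hτ).2.2.2.2
  calc |aR2 τ x| = 1 * |aR2 τ x| := (one_mul _).symm
    _ ≤ (2 * |x| / n) * |aR2 τ x| := by
        gcongr; rw [le_div_iff₀ hn0]; linarith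
    _ = (2 / (n * τ)) * ((|x| * τ) * |aR2 τ x|) := by field_simp
    _ ≤ (2 / (n * τ)) * (C * τ ^ 2 * wt τ x) := by gcongr
    _ ≤ (2 / (n * τ)) * (C * τ ^ 2 * (Real.exp (2/9) * gg (1/9) τ j)) := by
        gcongr; exact gauss_shift τ x j hτ hτ1 hx
    _ = _ := by field_simp

/-- stage one coefficients -/
noncomputable def cZ (τ δ : ℝ) (j : ℤ) : ℂ := (aR τ j : ℂ) * (1 - Ez (-δ) j)

noncomputable def er (δ s : ℝ) : ℂ := Complex.exp (Complex.I * ((Real.pi * (-δ) * s : ℝ) : ℂ))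

lemma er_norm (δ s : ℝ) : ‖er δ s‖ = 1 := by
  unfold er; rw [mul_comm]; exact Complex.norm_exp_ofReal_mul_I _

lemma er_sub (δ s : ℝ) : ‖1 - er δ s‖ ≤ Real.pi * |δ| * |s| := by
  rw [norm_sub_rev]
  refine (Real.norm_exp_I_mul_ofReal_sub_one_le).trans (le_of_eq ?_)
  rw [Real.norm_eq_abs, abs_mul, abs_mul, abs_neg, abs_of_pos Real.pi_pos]

lemma er_deriv (δ s : ℝ) : HasDerivAt (er δ) (-(Complex.I * Real.pi * δ) * er δ s) s := by
  unfold er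
  have h : HasDerivAt (fun s : ℝ => Complex.I * ((Real.pi * (-δ) * s : ℝ) : ℂ)) (-(Complex.I * Real.pi * δ)) s := by
    have h1 : HasDerivAt (fun s : ℝ => Real.pi * (-δ) * s) (Real.pi * (-δ)) s := by
      simpa using (hasDerivAt_id s).const_mul (Real.pi * (-δ))
    refine HasDerivAt.congr_deriv (h1.ofReal_comp.const_mul Complex.I) ?_
    push_cast; ring
  refine HasDerivAt.congr_deriv h.cexp ?_
  ring

lemma d2c_bound : ∃ C : ℝ, 0 < C ∧ ∀ τ : ℝ, 0 < τ → τ ≤ 1 → ∀ n : ℕ, 2 ≤ n → 1 ≤ n * τ → 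
    ∀ δ : ℝ, |δ| ≤ 2 / n → ∀ j : ℤ, ‖d2 (cZ τ δ) j‖ ≤ C * (τ / n) * gg (1/9) τ j := by
  obtain ⟨C, hC, h⟩ := aR_bounds
  have hpi := Real.pi_pos
  refine ⟨C * (6 * Real.pi + 4 * Real.pi ^ 2) * Real.exp (2/9), by positivity, fun τ hτ hτ1 n hn hnτ δ hδ j => ?_⟩
  have hn0 : (0:ℝ) < n := by positivity
  refine d2_of_fun (fun s => (aR τ s : ℂ) * (1 - er δ s))
    (fun s => (aR1 τ s : ℂ) * (1 - er δ s) + (aR τ s : ℂ) * (Complex.I * Real.pi * δ * er δ s))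
    (fun s => (aR2 τ s : ℂ) * (1 - er δ s) + 2 * (aR1 τ s : ℂ) * (Complex.I * Real.pi * δ * er δ s)
      + (aR τ s : ℂ) * (Real.pi ^ 2 * δ ^ 2 * er δ s)) j _ ?_ ?_ ?_
  · intro x
    refine HasDerivAt.congr_deriv ((aR_deriv τ x).ofReal_comp.mul ((er_deriv δ x).const_sub 1)) ?_
    ring
  · intro x
    refine HasDerivAt.congr_deriv (((aR1_deriv τ x).ofReal_comp.mul ((er_deriv δ x).const_sub 1)).add
      ((aR_deriv τ x).ofReal_comp.mul ((er_deriv δ x).const_mul (Complex.I * Real.pi * δ)))) ?_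
    linear_combination (-(aR τ x : ℂ) * Real.pi ^ 2 * δ ^ 2 * er δ x) * Complex.I_sq
  · intro x hx
    obtain ⟨b0, b0', b1, b2, b3⟩ := h τ x hτ
    have hw := wt_pos τ x
    have n1 : ‖(aR2 τ x : ℂ) * (1 - er δ x)‖ ≤ C * (2 * Real.pi) * (τ / n) * wt τ x := by
      rw [norm_mul, Complex.norm_real, Real.norm_eq_abs]
      calc _ ≤ |aR2 τ x| * (Real.pi * (2 / n) * |x|) := by
            refine mul_le_mul_of_nonneg_left ((er_sub δ x).trans ?_) (abs_nonneg _)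
            gcongr
        _ = (2 * Real.pi / (n * τ)) * ((|x| * τ) * |aR2 τ x|) := by field_simp
        _ ≤ (2 * Real.pi / (n * τ)) * (C * τ ^ 2 * wt τ x) := by gcongr
        _ = _ := by field_simp
    have nI : ‖Complex.I * Real.pi * δ * er δ x‖ ≤ Real.pi * (2 / n) := by
      rw [norm_mul, norm_mul, norm_mul, er_norm, Complex.norm_I, Complex.norm_real, Complex.norm_real,
        Real.norm_eq_abs, Real.norm_eq_abs, abs_of_pos hpi, one_mul, mul_one]
      gcongr
    have n2 : ‖2 * (aR1 τ x : ℂ) * (Complex.I * Real.pi * δ * er δ x)‖ ≤ C * (4 * Real.pi) * (τ / n) * wt τ x := by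
      rw [norm_mul, norm_mul, Complex.norm_real, Real.norm_eq_abs, Complex.norm_two]
      calc _ ≤ 2 * (C * τ * wt τ x) * (Real.pi * (2 / n)) := by gcongr
        _ = _ := by ring
    have n3 : ‖(aR τ x : ℂ) * (Real.pi ^ 2 * δ ^ 2 * er δ x)‖ ≤ C * (4 * Real.pi ^ 2) * (τ / n) * wt τ x := by
      rw [norm_mul, norm_mul, norm_mul, er_norm, norm_pow, norm_pow, Complex.norm_real, Complex.norm_real, Complex.norm_real,
        Real.norm_eq_abs, Real.norm_eq_abs, Real.norm_eq_abs, abs_of_pos hpi, abs_of_pos (aR_pos _ _), mul_one]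
      calc _ ≤ C * wt τ x * (Real.pi ^ 2 * (2 / n) ^ 2) := by gcongr
        _ = C * (4 * Real.pi ^ 2) * (1 / n * (1 / n)) * wt τ x := by ring
        _ ≤ C * (4 * Real.pi ^ 2) * (τ * (1 / n)) * wt τ x := by
            gcongr
            rw [div_le_iff₀ hn0]; linarith
        _ = _ := by ring
    calc _ ≤ C * (2 * Real.pi) * (τ / n) * wt τ x + C * (4 * Real.pi) * (τ / n) * wt τ x + C * (4 * Real.pi ^ 2) * (τ / n) * wt τ x :=
          (norm_add₃_le).trans (by gcongr)
      _ = C * (6 * Real.pi + 4 * Real.pi ^ 2) * (τ / n) * wt τ x := by ring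
      _ ≤ C * (6 * Real.pi + 4 * Real.pi ^ 2) * (τ / n) * (Real.exp (2/9) * gg (1/9) τ j) := by
          gcongr; exact gauss_shift τ x j hτ hτ1 hx
      _ = _ := by ring

lemma wt_g0 (τ : ℝ) (j : ℤ) (hj : j ≠ 0) : wt τ j = g0 (2/9) τ j := by
  unfold wt g0
  rw [if_neg hj, mul_pow, mul_pow, sq_abs]

lemma supc_bound : ∃ C : ℝ, 0 < C ∧ ∀ τ : ℝ, 0 < τ → ∀ n : ℕ, 2 ≤ n → 
    ∀ δ : ℝ, |δ| ≤ 2 / n → ∀ j : ℤ, ‖cZ τ δ j‖ ≤ C / (n * τ) * g0 (2/9) τ j := by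
  obtain ⟨C, hC, h⟩ := aR_bounds
  have hpi := Real.pi_pos
  refine ⟨2 * Real.pi * C, by positivity, fun τ hτ n hn δ hδ j => ?_⟩
  have hn0 : (0:ℝ) < n := by positivity
  by_cases hj : j = 0
  · subst hj; simp [cZ, Ez, g0]
  rw [← wt_g0 τ j hj]
  have : cZ τ δ j = (aR τ j : ℂ) * (1 - er δ j) := rfl
  rw [this, norm_mul, Complex.norm_real, Real.norm_eq_abs, abs_of_pos (aR_pos _ _)]
  calc _ ≤ aR τ j * (Real.pi * (2 / n) * |(j:ℝ)|) := by
        refine mul_le_mul_of_nonneg_left ((er_sub δ j).trans ?_) (aR_pos _ _).le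
        gcongr
    _ = (2 * Real.pi / (n * τ)) * ((|(j:ℝ)| * τ) * aR τ j) := by field_simp
    _ ≤ (2 * Real.pi / (n * τ)) * (C * wt τ j) := by
        exact mul_le_mul_of_nonneg_left (h τ j hτ).2.1 (by positivity)
    _ = _ := by ring

lemma supa_out : ∃ C : ℝ, 0 < C ∧ ∀ τ : ℝ, 0 < τ → ∀ n : ℕ, 2 ≤ n → 
    ∀ j : ℤ, (n:ℤ) ≤ |j| → ‖aZ τ j‖ ≤ C / (n * τ) * g0 (2/9) τ j := by
  obtain ⟨C, hC, h⟩ := aR_bounds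
  refine ⟨C, by positivity, fun τ hτ n hn j hjn => ?_⟩
  have hn0 : (0:ℝ) < n := by positivity
  have hj : j ≠ 0 := by rintro rfl; simp at hjn; omega
  rw [← wt_g0 τ j hj]
  have hj' : (n:ℝ) ≤ |(j:ℝ)| := by exact_mod_cast hjn
  unfold aZ
  rw [Complex.norm_real, Real.norm_eq_abs, abs_of_pos (aR_pos _ _)]
  calc _ = 1 * aR τ j := (one_mul _).symm
    _ ≤ (|(j:ℝ)| / n) * aR τ j := by
        have := aR_pos τ j
        gcongr; rw [le_div_iff₀ hn0]; linarith
    _ = 1 / (n * τ) * ((|(j:ℝ)| * τ) * aR τ j) := by field_simp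
    _ ≤ 1 / (n * τ) * (C * wt τ j) := by
        exact mul_le_mul_of_nonneg_left (h τ j hτ).2.1 (by positivity)
    _ = _ := by ring

noncomputable def mu (n : ℕ) (s : ℝ) : ℝ := 2 * (n:ℝ) ^ 2 * (1 - Real.cos (Real.pi * s / n))
noncomputable def mu1 (n : ℕ) (s : ℝ) : ℝ := 2 * Real.pi * n * Real.sin (Real.pi * s / n)
noncomputable def mu2 (n : ℕ) (s : ℝ) : ℝ := 2 * Real.pi ^ 2 * Real.cos (Real.pi * s / n)
noncomputable def bR (n : ℕ) (τ s : ℝ) : ℝ := Real.exp (-(τ ^ 2 * mu n s))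
noncomputable def bR1 (n : ℕ) (τ s : ℝ) : ℝ := -(τ ^ 2 * mu1 n s) * bR n τ s
noncomputable def bR2 (n : ℕ) (τ s : ℝ) : ℝ := (τ ^ 4 * mu1 n s ^ 2 - τ ^ 2 * mu2 n s) * bR n τ s

lemma bR_pos (n : ℕ) (τ s : ℝ) : 0 < bR n τ s := Real.exp_pos _

lemma lin_deriv (n : ℕ) (s : ℝ) : HasDerivAt (fun s : ℝ => Real.pi * s / n) (Real.pi / n) s := by
  refine HasDerivAt.congr_deriv (((hasDerivAt_id s).const_mul Real.pi).div_const (n:ℝ)) ?_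
  simp

lemma mu_deriv (n : ℕ) (hn : 0 < n) (s : ℝ) : HasDerivAt (mu n) (mu1 n s) s := by
  refine HasDerivAt.congr_deriv (((lin_deriv n s).cos.const_sub 1).const_mul (2 * (n:ℝ) ^ 2)) ?_
  unfold mu1
  field_simp

lemma mu1_deriv (n : ℕ) (hn : 0 < n) (s : ℝ) : HasDerivAt (mu1 n) (mu2 n s) s := by
  refine HasDerivAt.congr_deriv ((lin_deriv n s).sin.const_mul (2 * Real.pi * n)) ?_
  unfold mu2
  field_simp

lemma bR_deriv (n : ℕ) (hn : 0 < n) (τ s : ℝ) : HasDerivAt (bR n τ) (bR1 n τ s) s := by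
  refine HasDerivAt.congr_deriv (((mu_deriv n hn s).const_mul (τ ^ 2)).neg.exp) ?_
  unfold bR1 bR
  simp only [Pi.neg_apply]
  ring

lemma bR1_deriv (n : ℕ) (hn : 0 < n) (τ s : ℝ) : HasDerivAt (bR1 n τ) (bR2 n τ s) s := by
  refine HasDerivAt.congr_deriv (((mu1_deriv n hn s).const_mul (τ ^ 2)).neg.mul (bR_deriv n hn τ s)) ?_
  unfold bR2 bR1
  simp only [Pi.neg_apply]
  ring

lemma mu_sin (n : ℕ) (s : ℝ) : mu n s = 4 * (n:ℝ) ^ 2 * Real.sin (Real.pi * s / (2 * n)) ^ 2 := by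
  unfold mu
  have : Real.pi * s / n = 2 * (Real.pi * s / (2 * n)) := by
    rcases eq_or_ne (n:ℝ) 0 with h | h
    · simp [h]
    · field_simp
  rw [this, Real.cos_two_mul, Real.cos_sq']
  ring

lemma sin_low (x : ℝ) (h0 : 0 ≤ x) (h1 : x ≤ 3 * Real.pi / 4) : 2 / (3 * Real.pi) * x ≤ Real.sin x := by
  have hpi := Real.pi_pos
  rcases le_total x (Real.pi / 2) with h | h
  · refine le_trans ?_ (Real.mul_le_sin h0 h)
    gcongr
    linarith
  · rw [← Real.sin_pi_sub]
    refine le_trans ?_ (Real.mul_le_sin (by linarith) (by linarith))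
    calc 2 / (3 * Real.pi) * x ≤ 2 / (3 * Real.pi) * (3 * Real.pi / 4) := by gcongr
      _ = 2 / Real.pi * (Real.pi / 4) := by field_simp; 
      _ ≤ _ := by gcongr; linarith

lemma sin_low_sq (x : ℝ) (h1 : |x| ≤ 3 * Real.pi / 4) : (2 / (3 * Real.pi) * x) ^ 2 ≤ Real.sin x ^ 2 := by
  have h := sin_low |x| (abs_nonneg x) h1
  have hpi := Real.pi_pos
  have e : Real.sin |x| ^ 2 = Real.sin x ^ 2 := by
    rcases abs_choice x with h | h <;> rw [h]
    rw [Real.sin_neg, neg_sq]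
  rw [← e, ← sq_abs, abs_mul, abs_of_pos (by positivity : 0 < 2 / (3 * Real.pi))]
  exact pow_le_pow_left₀ (by positivity) h 2

lemma mu_low (n : ℕ) (hn : 0 < n) (s : ℝ) (hs : |s| ≤ 3 / 2 * n) : 4 / 9 * s ^ 2 ≤ mu n s := by
  have hpi := Real.pi_pos
  have hn0 : (0:ℝ) < n := by exact_mod_cast hn
  rw [mu_sin]
  have h : |Real.pi * s / (2 * n)| ≤ 3 * Real.pi / 4 := by
    rw [abs_div, abs_mul, abs_of_pos hpi, abs_of_pos (by positivity : (0:ℝ) < 2 * n),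
      div_le_iff₀ (by positivity)]
    nlinarith
  calc 4 / 9 * s ^ 2 = 4 * (n:ℝ) ^ 2 * (2 / (3 * Real.pi) * (Real.pi * s / (2 * n))) ^ 2 := by
        field_simp; ring
    _ ≤ _ := by gcongr ?_ * ?_; exact sin_low_sq _ h

lemma bR_le (n : ℕ) (hn : 0 < n) (τ s : ℝ) (hs : |s| ≤ 3 / 2 * n) :
    bR n τ s ≤ Real.exp (-(4/9) * (|s| * τ) ^ 2) := by
  unfold bR
  apply Real.exp_le_exp.2
  rw [mul_pow, sq_abs]
  nlinarith [mul_le_mul_of_nonneg_left (mu_low n hn s hs) (sq_nonneg τ)]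

lemma exp_diff (x y z : ℝ) (hx : z ≤ x) (hy : z ≤ y) :
    |Real.exp (-x) - Real.exp (-y)| ≤ |x - y| * Real.exp (-z) := by
  wlog h : x ≤ y generalizing x y
  · rw [abs_sub_comm, abs_sub_comm x y]; exact this y x hy hx (by linarith)
  rw [abs_of_nonneg (by simpa using h), abs_of_nonpos (by linarith)]
  have e : Real.exp (-y) = Real.exp (-x) * Real.exp (x - y) := by rw [← Real.exp_add]; ring_nf
  have h1 := Real.add_one_le_exp (x - y)
  have h2 : Real.exp (-x) ≤ Real.exp (-z) := Real.exp_le_exp.2 (by linarith)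
  have h3 := Real.exp_pos (-x)
  rw [e]
  nlinarith [mul_le_mul_of_nonneg_left h1 h3.le, mul_le_mul_of_nonneg_left h2 (sub_nonneg.2 h)]

lemma mu_diffs (n : ℕ) (hn : 0 < n) (s : ℝ) (hs : |s| ≤ 3 / 2 * n) :
    |Real.pi ^ 2 * s ^ 2 - mu n s| ≤ Real.pi ^ 3 * |s| ^ 3 / (2 * n) ∧
    |2 * Real.pi ^ 2 * s - mu1 n s| ≤ 2 * Real.pi ^ 3 * |s| ^ 2 / n ∧
    |2 * Real.pi ^ 2 - mu2 n s| ≤ 5 * Real.pi ^ 3 * |s| / n := by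
  have hpi := Real.pi_pos
  have hpi4 := Real.pi_lt_d2
  have hn0 : (0:ℝ) < n := by exact_mod_cast hn
  have hφ : |Real.pi * s / (2 * n)| = Real.pi * |s| / (2 * n) := by
    rw [abs_div, abs_mul, abs_of_pos hpi, abs_of_pos (by positivity : (0:ℝ) < 2 * n)]
  have hθ : |Real.pi * s / n| = Real.pi * |s| / n := by
    rw [abs_div, abs_mul, abs_of_pos hpi, abs_of_pos hn0]
  have hφ3 : |Real.pi * s / (2 * n)| ≤ 3 := by
    rw [hφ, div_le_iff₀ (by positivity)]
    nlinarith [abs_nonneg s]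
  have hθ5 : |Real.pi * s / n| ≤ 5 := by
    rw [hθ, div_le_iff₀ (by positivity)]
    nlinarith [abs_nonneg s]
  refine ⟨?_, ?_, ?_⟩
  · rw [mu_sin]
    set φ := Real.pi * s / (2 * n) with hd
    have e : Real.pi ^ 2 * s ^ 2 = 4 * (n:ℝ) ^ 2 * φ ^ 2 := by rw [hd]; field_simp; ring
    have h1 : |φ - Real.sin φ| ≤ |φ| ^ 3 / 6 := Real.abs_sub_sin_le φ
    have h2 : |φ + Real.sin φ| ≤ 2 * |φ| := by
      refine (abs_add_le _ _).trans ?_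
      have := Real.abs_sin_le_abs (x := φ)
      linarith
    have h3 : |φ ^ 2 - Real.sin φ ^ 2| ≤ |φ| ^ 3 := by
      have : φ ^ 2 - Real.sin φ ^ 2 = (φ - Real.sin φ) * (φ + Real.sin φ) := by ring
      rw [this, abs_mul]
      calc _ ≤ |φ| ^ 3 / 6 * (2 * |φ|) := by gcongr
        _ = |φ| ^ 3 / 3 * |φ| := by ring
        _ ≤ |φ| ^ 3 / 3 * 3 := by gcongr
        _ = _ := by ring
    rw [e, ← mul_sub, abs_mul, abs_of_pos (by positivity : 0 < 4 * (n:ℝ) ^ 2)]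
    calc _ ≤ 4 * (n:ℝ) ^ 2 * |φ| ^ 3 := by gcongr
      _ = _ := by rw [hφ]; field_simp; ring
  · unfold mu1
    set θ := Real.pi * s / n with hd
    have e : 2 * Real.pi ^ 2 * s = 2 * Real.pi * n * θ := by rw [hd]; field_simp
    have h1 : |θ - Real.sin θ| ≤ |θ| ^ 3 / 6 := Real.abs_sub_sin_le θ
    rw [e, ← mul_sub, abs_mul, abs_of_pos (by positivity : 0 < 2 * Real.pi * n)]
    calc _ ≤ 2 * Real.pi * n * (|θ| ^ 3 / 6) := by gcongr
      _ = 2 * Real.pi * n * (|θ| ^ 2 / 6 * |θ|) := by ring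
      _ ≤ 2 * Real.pi * n * (|θ| ^ 2 / 6 * 5) := by gcongr
      _ ≤ 2 * Real.pi * n * |θ| ^ 2 := by gcongr; nlinarith [sq_nonneg |θ|]
      _ = _ := by rw [hθ]; field_simp
  · unfold mu2
    set θ := Real.pi * s / n with hd
    have h1 := Real.one_sub_sq_div_two_le_cos (x := θ)
    have h2 := Real.cos_le_one θ
    have e : 2 * Real.pi ^ 2 - 2 * Real.pi ^ 2 * Real.cos θ = 2 * Real.pi ^ 2 * (1 - Real.cos θ) := by ring
    rw [e, abs_of_nonneg (mul_nonneg (by positivity) (by linarith))]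
    have h3 : 1 - Real.cos θ ≤ 5 / 2 * |θ| := by
      nlinarith [sq_abs θ, abs_nonneg θ]
    calc _ ≤ 2 * Real.pi ^ 2 * (5 / 2 * |θ|) := by gcongr
      _ = _ := by rw [hθ]; field_simp

lemma ab_diff (n : ℕ) (hn : 0 < n) (τ s : ℝ) (hτ : 0 < τ) (hs : |s| ≤ 3 / 2 * n) :
    |aR τ s - bR n τ s| ≤ Real.pi ^ 3 / (2 * (n * τ)) *
      ((|s| * τ) ^ 3 * Real.exp (-(4/9) * (|s| * τ) ^ 2)) := by
  have hn0 : (0:ℝ) < n := by exact_mod_cast hn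
  have hpi : 4 / 9 ≤ Real.pi ^ 2 := by nlinarith [Real.pi_gt_three]
  have h := exp_diff (Real.pi ^ 2 * (s * τ) ^ 2) (τ ^ 2 * mu n s) (4/9 * (|s| * τ) ^ 2)
    (by rw [mul_pow, mul_pow, sq_abs]; gcongr)
    (by rw [mul_pow, sq_abs]; nlinarith [mul_le_mul_of_nonneg_left (mu_low n hn s hs) (sq_nonneg τ)])
  have e : Real.pi ^ 2 * (s * τ) ^ 2 - τ ^ 2 * mu n s = τ ^ 2 * (Real.pi ^ 2 * s ^ 2 - mu n s) := by ring
  rw [e, abs_mul, abs_of_pos (by positivity : 0 < τ ^ 2)] at h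
  unfold aR bR
  refine h.trans ?_
  rw [neg_mul]
  calc _ ≤ τ ^ 2 * (Real.pi ^ 3 * |s| ^ 3 / (2 * n)) * Real.exp (-(4/9 * (|s| * τ) ^ 2)) := by
        gcongr; exact (mu_diffs n hn s hs).1
    _ = _ := by field_simp

lemma ab_bounds : ∃ C : ℝ, 0 < C ∧ ∀ (n : ℕ) (τ s : ℝ), 0 < n → 0 < τ → |s| ≤ 3 / 2 * n →
    |aR τ s - bR n τ s| ≤ C / (n * τ) * wt τ s ∧
    |aR2 τ s - bR2 n τ s| ≤ C * (τ / n) * wt τ s := by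
  obtain ⟨P, hP1, hP⟩ := poly_exp
  have hpi := Real.pi_pos
  refine ⟨P * (Real.pi ^ 3 + 9 * Real.pi ^ 5 + 2 * Real.pi ^ 7 + 5 * Real.pi ^ 3), by positivity, ?_⟩
  intro n τ s hn hτ hs
  have hn0 : (0:ℝ) < n := by exact_mod_cast hn
  have hd := ab_diff n hn τ s hτ hs
  obtain ⟨m0, m1, m2⟩ := mu_diffs n hn s hs
  set r := |s| * τ with hr
  have hr0 : 0 ≤ r := by positivity
  set E := Real.exp (-(4/9) * r ^ 2) with hE
  have hE0 : 0 < E := Real.exp_pos _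
  have haE : aR τ s ≤ E := aR_le τ s
  have ha := aR_pos τ s
  have hw := wt_pos τ s
  have p1 : r * E ≤ P * wt τ s := by
    have := hP r hr0 1 (by norm_num)
    rw [pow_one] at this
    exact this
  have p3 : r ^ 3 * E ≤ P * wt τ s := hP r hr0 3 (by norm_num)
  have p5 : r ^ 5 * E ≤ P * wt τ s := hP r hr0 5 (by norm_num)
  constructor
  · calc _ ≤ _ := hd
      _ ≤ Real.pi ^ 3 / (2 * (n * τ)) * (P * wt τ s) := by gcongr
      _ = (P * (Real.pi ^ 3 / 2)) / (n * τ) * wt τ s := by field_simp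
      _ ≤ _ := by
        gcongr
        nlinarith [pow_pos hpi 3, pow_pos hpi 5, pow_pos hpi 7]
  · have hm1 : |mu1 n s| ≤ 2 * Real.pi ^ 2 * |s| := by
      unfold mu1
      rw [abs_mul, abs_of_pos (by positivity : 0 < 2 * Real.pi * n)]
      have := Real.abs_sin_le_abs (x := Real.pi * s / n)
      rw [abs_div, abs_mul, abs_of_pos hpi, abs_of_pos hn0] at this
      calc _ ≤ 2 * Real.pi * n * (Real.pi * |s| / n) := by gcongr
        _ = _ := by field_simp
    have hm2 : |mu2 n s| ≤ 2 * Real.pi ^ 2 := by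
      unfold mu2
      rw [abs_mul, abs_of_pos (by positivity : 0 < 2 * Real.pi ^ 2)]
      exact mul_le_of_le_one_right (by positivity) (Real.abs_cos_le_one _)
    have e : aR2 τ s - bR2 n τ s = τ ^ 4 * ((2 * Real.pi ^ 2 * s - mu1 n s) * (2 * Real.pi ^ 2 * s + mu1 n s)) * aR τ s
        + τ ^ 4 * mu1 n s ^ 2 * (aR τ s - bR n τ s)
        + -(τ ^ 2 * (2 * Real.pi ^ 2 - mu2 n s) * aR τ s)
        + -(τ ^ 2 * mu2 n s * (aR τ s - bR n τ s)) := by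
      unfold aR2 bR2; ring
    have t1 : |τ ^ 4 * ((2 * Real.pi ^ 2 * s - mu1 n s) * (2 * Real.pi ^ 2 * s + mu1 n s)) * aR τ s|
        ≤ 8 * Real.pi ^ 5 * (τ / n) * (r ^ 3 * E) := by
      rw [abs_mul, abs_mul, abs_mul, abs_of_pos ha, abs_of_pos (by positivity : 0 < τ ^ 4)]
      have : |2 * Real.pi ^ 2 * s + mu1 n s| ≤ 4 * Real.pi ^ 2 * |s| := by
        refine (abs_add_le _ _).trans ?_
        rw [abs_mul, abs_of_pos (by positivity : 0 < 2 * Real.pi ^ 2)]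
        linarith
      calc _ ≤ τ ^ 4 * ((2 * Real.pi ^ 3 * |s| ^ 2 / n) * (4 * Real.pi ^ 2 * |s|)) * E := by gcongr
        _ = _ := by rw [hr]; ring
    have t2 : |τ ^ 4 * mu1 n s ^ 2 * (aR τ s - bR n τ s)| ≤ 2 * Real.pi ^ 7 * (τ / n) * (r ^ 5 * E) := by
      rw [abs_mul, abs_mul, abs_pow, abs_pow, abs_of_pos hτ]
      calc _ ≤ τ ^ 4 * (2 * Real.pi ^ 2 * |s|) ^ 2 * (Real.pi ^ 3 / (2 * (n * τ)) * (r ^ 3 * E)) := by gcongr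
        _ = _ := by rw [hr]; field_simp
    have t3 : |-(τ ^ 2 * (2 * Real.pi ^ 2 - mu2 n s) * aR τ s)| ≤ 5 * Real.pi ^ 3 * (τ / n) * (r * E) := by
      rw [abs_neg, abs_mul, abs_mul, abs_pow, abs_of_pos hτ, abs_of_pos ha]
      calc _ ≤ τ ^ 2 * (5 * Real.pi ^ 3 * |s| / n) * E := by gcongr
        _ = _ := by rw [hr]; ring
    have t4 : |-(τ ^ 2 * mu2 n s * (aR τ s - bR n τ s))| ≤ Real.pi ^ 5 * (τ / n) * (r ^ 3 * E) := by
      rw [abs_neg, abs_mul, abs_mul, abs_pow, abs_of_pos hτ]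
      calc _ ≤ τ ^ 2 * (2 * Real.pi ^ 2) * (Real.pi ^ 3 / (2 * (n * τ)) * (r ^ 3 * E)) := by gcongr
        _ = _ := by rw [hr]; field_simp
    rw [e]
    have tri : ∀ a b c d : ℝ, |a + b + c + d| ≤ |a| + |b| + |c| + |d| := fun a b c d =>
      (abs_add_le _ _).trans (by gcongr; exact (abs_add_le _ _).trans (by gcongr; exact abs_add_le _ _))
    have hτn : 0 < τ / n := by positivity
    calc _ ≤ _ := tri _ _ _ _
      _ ≤ 8 * Real.pi ^ 5 * (τ / n) * (P * wt τ s) + 2 * Real.pi ^ 7 * (τ / n) * (P * wt τ s)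
          + 5 * Real.pi ^ 3 * (τ / n) * (P * wt τ s) + Real.pi ^ 5 * (τ / n) * (P * wt τ s) := by
          refine add_le_add (add_le_add (add_le_add (t1.trans ?_) (t2.trans ?_)) (t3.trans ?_)) (t4.trans ?_) <;> gcongr
      _ = P * (9 * Real.pi ^ 5 + 2 * Real.pi ^ 7 + 5 * Real.pi ^ 3) * (τ / n) * wt τ s := by ring
      _ ≤ _ := by
          gcongr
          nlinarith [pow_pos hpi 3]

noncomputable def bZ (n : ℕ) (τ : ℝ) (j : ℤ) : ℂ := (bR n τ j : ℂ)

lemma bZ_per (n : ℕ) (hn : 0 < n) (τ : ℝ) (j : ℤ) : bZ n τ (j + 2 * n) = bZ n τ j := by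
  have hn0 : (0:ℝ) < n := by exact_mod_cast hn
  unfold bZ bR mu
  have : Real.pi * ((j + 2 * n : ℤ) : ℝ) / n = Real.pi * j / n + 2 * Real.pi := by
    push_cast; field_simp
  rw [this, Real.cos_add_two_pi]

lemma d2ab_bound : ∃ C : ℝ, 0 < C ∧ ∀ τ : ℝ, 0 < τ → τ ≤ 1 → ∀ n : ℕ, 2 ≤ n → ∀ j : ℤ,
    j ∈ Finset.Ico (-(n:ℤ)) n → ‖d2 (aZ τ) j - d2 (bZ n τ) j‖ ≤ C * (τ / n) * gg (1/9) τ j := by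
  obtain ⟨C, hC, h⟩ := ab_bounds
  refine ⟨C * Real.exp (2/9), by positivity, fun τ hτ hτ1 n hn j hj => ?_⟩
  have hn0 : (0:ℝ) < n := by positivity
  have hn2 : (2:ℝ) ≤ n := by exact_mod_cast hn
  rw [Finset.mem_Ico] at hj
  have hj1 : -(n:ℝ) ≤ j := by exact_mod_cast hj.1
  have hj2 : (j:ℝ) ≤ n := by exact_mod_cast hj.2.le
  have e : d2 (aZ τ) j - d2 (bZ n τ) j = d2 (fun j : ℤ => aZ τ j - bZ n τ j) j := by
    unfold d2; ring
  rw [e]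
  refine d2_of_fun (fun s => (aR τ s : ℂ) - (bR n τ s : ℂ)) (fun s => (aR1 τ s : ℂ) - (bR1 n τ s : ℂ))
    (fun s => (aR2 τ s : ℂ) - (bR2 n τ s : ℂ)) j _
    (fun x => (aR_deriv τ x).ofReal_comp.sub (bR_deriv n (by omega) τ x).ofReal_comp)
    (fun x => (aR1_deriv τ x).ofReal_comp.sub (bR1_deriv n (by omega) τ x).ofReal_comp) ?_
  intro x hx
  rw [← Complex.ofReal_sub, Complex.norm_real, Real.norm_eq_abs]
  have hx3 : |x| ≤ 3 / 2 * n := abs_le.2 ⟨by linarith [hx.1], by linarith [hx.2]⟩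
  refine (h n τ x (by omega) hτ hx3).2.trans ?_
  calc _ ≤ C * (τ / n) * (Real.exp (2/9) * gg (1/9) τ j) := by
        gcongr; exact gauss_shift τ x j hτ hτ1 hx
    _ = _ := by ring

lemma supab_bound : ∃ C : ℝ, 0 < C ∧ ∀ τ : ℝ, 0 < τ → ∀ n : ℕ, 2 ≤ n → ∀ j : ℤ,
    j ∈ Finset.Ico (-(n:ℤ)) n → ‖aZ τ j - bZ n τ j‖ ≤ C / (n * τ) * g0 (2/9) τ j := by
  obtain ⟨C, hC, h⟩ := ab_bounds
  refine ⟨C, hC, fun τ hτ n hn j hj => ?_⟩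
  have hn0 : (0:ℝ) < n := by positivity
  by_cases hj0 : j = 0
  · subst hj0; simp [aZ, bZ, aR, bR, mu, g0]
  rw [← wt_g0 τ j hj0]
  rw [Finset.mem_Ico] at hj
  have hj1 : -(n:ℝ) ≤ j := by exact_mod_cast hj.1
  have hj2 : (j:ℝ) ≤ n := by exact_mod_cast hj.2.le
  unfold aZ bZ
  rw [← Complex.ofReal_sub, Complex.norm_real, Real.norm_eq_abs]
  exact (h n τ j (by omega) hτ (abs_le.2 ⟨by linarith, by linarith⟩)).1

lemma mu_nonneg (n : ℕ) (s : ℝ) : 0 ≤ mu n s := by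
  unfold mu
  have := Real.cos_le_one (Real.pi * s / n)
  exact mul_nonneg (by positivity) (by linarith)

lemma bR_le_one (n : ℕ) (τ s : ℝ) : bR n τ s ≤ 1 := by
  unfold bR
  apply Real.exp_le_one_iff.2
  have := mu_nonneg n s
  have : 0 ≤ τ ^ 2 * mu n s := by positivity
  linarith

lemma d2b_small (τ : ℝ) (hτ : 0 < τ) (n : ℕ) (hn : 2 ≤ n) (hnτ : n * τ ≤ 1) (j : ℤ) :
    ‖d2 (bZ n τ) j‖ ≤ 6 * Real.pi ^ 2 * τ ^ 2 := by
  have hpi := Real.pi_pos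
  refine d2_of_fun (fun s => (bR n τ s : ℂ)) (fun s => (bR1 n τ s : ℂ)) (fun s => (bR2 n τ s : ℂ)) j _
    (fun x => (bR_deriv n (by omega) τ x).ofReal_comp) (fun x => (bR1_deriv n (by omega) τ x).ofReal_comp) ?_
  intro x hx
  rw [Complex.norm_real, Real.norm_eq_abs]
  have hb := bR_le_one n τ x
  have hb0 := bR_pos n τ x
  have hm1 : mu1 n x ^ 2 ≤ 4 * Real.pi ^ 2 * n ^ 2 := by
    unfold mu1
    have := Real.sin_sq_le_one (Real.pi * x / n)
    calc _ = 4 * Real.pi ^ 2 * n ^ 2 * Real.sin (Real.pi * x / n) ^ 2 := by ring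
      _ ≤ _ := mul_le_of_le_one_right (by positivity) this
  have hm2 : |mu2 n x| ≤ 2 * Real.pi ^ 2 := by
    unfold mu2
    rw [abs_mul, abs_of_pos (by positivity : 0 < 2 * Real.pi ^ 2)]
    exact mul_le_of_le_one_right (by positivity) (Real.abs_cos_le_one _)
  unfold bR2
  rw [abs_mul, abs_of_pos hb0]
  refine (mul_le_of_le_one_right (abs_nonneg _) hb).trans ((abs_sub _ _).trans ?_)
  rw [abs_of_nonneg (by positivity), abs_mul, abs_of_pos (by positivity : 0 < τ ^ 2)]
  have h1 : (n * τ) ^ 2 ≤ 1 := pow_le_one₀ (by positivity) hnτ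
  calc _ ≤ τ ^ 4 * (4 * Real.pi ^ 2 * n ^ 2) + τ ^ 2 * (2 * Real.pi ^ 2) := by gcongr
    _ = 4 * Real.pi ^ 2 * τ ^ 2 * (n * τ) ^ 2 + τ ^ 2 * (2 * Real.pi ^ 2) := by ring
    _ ≤ 4 * Real.pi ^ 2 * τ ^ 2 * 1 + τ ^ 2 * (2 * Real.pi ^ 2) := by gcongr
    _ = _ := by ring

noncomputable def SS (τ u : ℝ) : ℂ := ∑' j : ℤ, aZ τ j * Ez u j
noncomputable def Sn (n : ℕ) (τ v : ℝ) : ℂ := ∑ j ∈ Finset.Ico (-(n:ℤ)) n, bZ n τ j * Ez v j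

lemma aZ_norm (τ : ℝ) (j : ℤ) : ‖aZ τ j‖ = gg (Real.pi ^ 2) τ j := by
  unfold aZ gg
  rw [Complex.norm_real, Real.norm_eq_abs, abs_of_pos (aR_pos _ _), neg_mul]
  rfl

lemma aZ_summable (τ : ℝ) (hτ : 0 < τ) : Summable fun j => ‖aZ τ j‖ := by
  simp only [aZ_norm]
  exact (gaussZ _ (by have := Real.pi_pos; positivity) τ hτ).1

lemma gg_summable (c : ℝ) (hc : 0 < c) (τ : ℝ) (hτ : 0 < τ) : Summable (gg c τ) := (gaussZ c hc τ hτ).1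

/-- sum bounded by Gaussians -/
lemma tsum_bd (f : ℤ → ℂ) (B : ℤ → ℝ) (u K : ℝ) (hB : Summable B) (hK : ∑' j, B j ≤ K)
    (h : ∀ j, ‖f j‖ ≤ B j) : ‖∑' j, f j * Ez u j‖ ≤ K := by
  refine le_trans (tsum_of_norm_bounded hB.hasSum fun j => ?_) hK
  rw [norm_mul, Ez_norm, mul_one]; exact h j

lemma tsum_diff_bd (f g : ℤ → ℂ) (s : Finset ℤ) (B : ℤ → ℝ) (u K : ℝ) (hf : Summable fun j => f j * Ez u j)
    (hB : Summable B) (hK : ∑' j, B j ≤ K)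
    (h1 : ∀ j ∈ s, ‖f j - g j‖ ≤ B j) (h2 : ∀ j, j ∉ s → ‖f j‖ ≤ B j) :
    ‖∑' j, f j * Ez u j - ∑ j ∈ s, g j * Ez u j‖ ≤ K := by
  have hg : HasSum (fun j => (if j ∈ s then g j else 0) * Ez u j) (∑ j ∈ s, g j * Ez u j) := by
    have := hasSum_sum_of_ne_finset_zero (L := SummationFilter.unconditional ℤ) (f := fun j => (if j ∈ s then g j else 0) * Ez u j) (s := s)
      (fun j hj => by simp [hj])
    convert this using 1
    exact Finset.sum_congr rfl fun j hj => by simp [hj]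
  rw [← hg.tsum_eq, ← hf.tsum_sub hg.summable]
  have e : (fun j => f j * Ez u j - (if j ∈ s then g j else 0) * Ez u j)
      = fun j => (f j - if j ∈ s then g j else 0) * Ez u j := by funext j; ring
  rw [e]
  refine tsum_bd _ B u K hB hK fun j => ?_
  by_cases hj : j ∈ s
  · simpa [hj] using h1 j hj
  · simpa [hj] using h2 j hj

lemma norm_om_mul (u : ℝ) (z : ℂ) : ‖((4 * om u : ℝ) : ℂ) * z‖ = 4 * om u * ‖z‖ := by
  rw [norm_mul, Complex.norm_real, Real.norm_eq_abs, abs_of_nonneg (by have := om_nonneg u; positivity)]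

lemma tsum_smul_gauss (c : ℝ) (hc : 0 < c) (τ : ℝ) (hτ : 0 < τ) (hτ1 : τ ≤ 1) (k : ℝ) (hk : 0 ≤ k) :
    Summable (fun j => k * gg c τ j) ∧ ∑' j, k * gg c τ j ≤ k * ((Real.sqrt (Real.pi / c) + 1) / τ) := by
  obtain ⟨h1, h2⟩ := gaussZ c hc τ hτ
  refine ⟨h1.mul_left k, ?_⟩
  rw [tsum_mul_left]
  exact mul_le_mul_of_nonneg_left (h2 hτ1) hk

lemma tsum_smul_gauss0 (c : ℝ) (hc : 0 < c) (τ : ℝ) (hτ : 0 < τ) (k : ℝ) (hk : 0 ≤ k) :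
    Summable (fun j => k * g0 c τ j) ∧ ∑' j, k * g0 c τ j ≤ k * (Real.sqrt (Real.pi / c) / τ) := by
  obtain ⟨h1, h2⟩ := gaussZ0 c hc τ hτ
  refine ⟨h1.mul_left k, ?_⟩
  rw [tsum_mul_left]
  exact mul_le_mul_of_nonneg_left h2 hk

lemma SS_bounds : ∃ C : ℝ, 0 < C ∧ ∀ τ u : ℝ, 0 < τ → τ ≤ 1 →
    ‖SS τ u‖ ≤ C / τ ∧ om u * ‖SS τ u‖ ≤ C * τ := by
  obtain ⟨D, hD, hd⟩ := d2a_bound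
  have hpi := Real.pi_pos
  refine ⟨(Real.sqrt (Real.pi / (Real.pi ^ 2)) + 1) + D * (Real.sqrt (Real.pi / (1/9)) + 1), by positivity, ?_⟩
  intro τ u hτ hτ1
  have p1 : 0 ≤ Real.sqrt (Real.pi / (Real.pi ^ 2)) := Real.sqrt_nonneg _
  have p2 : 0 ≤ Real.sqrt (Real.pi / (1/9)) := Real.sqrt_nonneg _
  constructor
  · obtain ⟨h1, h2⟩ := gaussZ (Real.pi ^ 2) (by positivity) τ hτ
    refine (tsum_bd _ _ u _ h1 (h2 hτ1) fun j => (aZ_norm τ j).le).trans ?_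
    refine div_le_div_of_nonneg_right ?_ hτ.le
    have : 0 ≤ D * (Real.sqrt (Real.pi / (1/9)) + 1) := by positivity
    linarith
  · obtain ⟨h1, h2⟩ := tsum_smul_gauss (1/9) (by norm_num) τ hτ hτ1 (D * τ ^ 2) (by positivity)
    have h := tsum_bd _ _ u _ h1 h2 (hd τ hτ hτ1)
    rw [← abel_tsum _ (aZ_summable τ hτ), norm_om_mul] at h
    have e : D * τ ^ 2 * ((Real.sqrt (Real.pi / (1/9)) + 1) / τ) = D * (Real.sqrt (Real.pi / (1/9)) + 1) * τ := by
      field_simp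
    rw [e] at h
    have o := mul_nonneg (om_nonneg u) (norm_nonneg (SS τ u))
    unfold SS at o ⊢
    have : 0 ≤ (Real.sqrt (Real.pi / (Real.pi ^ 2)) + 1) * τ := by positivity
    nlinarith

lemma SS_sub (τ u δ : ℝ) (hτ : 0 < τ) : SS τ u - SS τ (u - δ) = ∑' j, cZ τ δ j * Ez u j := by
  unfold SS
  rw [← (summable_mul_Ez _ (aZ_summable τ hτ) u).tsum_sub (summable_mul_Ez _ (aZ_summable τ hτ) _)]
  congr 1
  funext j
  rw [sub_eq_add_neg u δ, Ez_add']
  unfold cZ aZ; ring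

lemma cZ_summable (τ δ : ℝ) (hτ : 0 < τ) : Summable fun j => ‖cZ τ δ j‖ := by
  refine Summable.of_nonneg_of_le (fun j => norm_nonneg _) (fun j => ?_) ((aZ_summable τ hτ).mul_left 2)
  unfold cZ
  rw [norm_mul, mul_comm]
  refine mul_le_mul_of_nonneg_right ?_ (norm_nonneg _)
  refine (norm_sub_le _ _).trans ?_
  rw [Ez_norm, norm_one]; norm_num

lemma stage1 : ∃ C : ℝ, 0 < C ∧ ∀ τ : ℝ, 0 < τ → ∀ n : ℕ, 2 ≤ n → ∀ u v : ℝ, |u - v| ≤ 2 / n →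
    ‖SS τ u - SS τ v‖ ≤ C / (n * τ ^ 2) ∧
    (τ ≤ 1 → 1 ≤ n * τ → om u * ‖SS τ u - SS τ v‖ ≤ C / n) := by
  obtain ⟨D, hD, hd⟩ := supc_bound
  obtain ⟨D', hD', hd'⟩ := d2c_bound
  have p1 : 0 ≤ Real.sqrt (Real.pi / (2/9)) := Real.sqrt_nonneg _
  have p2 : 0 ≤ Real.sqrt (Real.pi / (1/9)) := Real.sqrt_nonneg _
  refine ⟨D * Real.sqrt (Real.pi / (2/9)) + D' * (Real.sqrt (Real.pi / (1/9)) + 1), by positivity, ?_⟩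
  intro τ hτ n hn u v huv
  have hn0 : (0:ℝ) < n := by positivity
  have e := SS_sub τ u (u - v) hτ
  rw [sub_sub_cancel] at e
  constructor
  · rw [e]
    obtain ⟨h1, h2⟩ := tsum_smul_gauss0 (2/9) (by norm_num) τ hτ (D / (n * τ)) (by positivity)
    refine (tsum_bd _ _ u _ h1 h2 (hd τ hτ n hn _ huv)).trans ?_
    have : D / (n * τ) * (Real.sqrt (Real.pi / (2/9)) / τ) = (D * Real.sqrt (Real.pi / (2/9))) / (n * τ ^ 2) := by
      field_simp
    rw [this]
    gcongr
    have : 0 ≤ D' * (Real.sqrt (Real.pi / (1/9)) + 1) := by positivity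
    linarith
  · intro hτ1 hnτ
    obtain ⟨h1, h2⟩ := tsum_smul_gauss (1/9) (by norm_num) τ hτ hτ1 (D' * (τ / n)) (by positivity)
    have h := tsum_bd _ _ u _ h1 h2 (hd' τ hτ hτ1 n hn hnτ _ huv)
    rw [← abel_tsum _ (cZ_summable τ _ hτ), norm_om_mul, ← e] at h
    have e2 : D' * (τ / n) * ((Real.sqrt (Real.pi / (1/9)) + 1) / τ) = D' * (Real.sqrt (Real.pi / (1/9)) + 1) / n := by
      field_simp
    rw [e2] at h
    have o := mul_nonneg (om_nonneg u) (norm_nonneg (SS τ u - SS τ v))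
    rw [add_div]
    have : 0 ≤ D * Real.sqrt (Real.pi / (2/9)) / n := by positivity
    nlinarith

lemma Ez_per (n : ℕ) (hn : 0 < n) (v : ℝ) (m : ℤ) (hv : v = m / n) (j : ℤ) :
    Ez v (j + 2 * n) = Ez v j := by
  have hn0 : (n:ℂ) ≠ 0 := by exact_mod_cast hn.ne'
  unfold Ez
  have : Complex.I * ((Real.pi * v * ((j + 2 * n : ℤ) : ℝ) : ℝ) : ℂ)
      = Complex.I * ((Real.pi * v * j : ℝ) : ℂ) + m * (2 * Real.pi * Complex.I) := by
    rw [hv]; push_cast; field_simp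
  rw [this, Complex.exp_add, Complex.exp_int_mul_two_pi_mul_I, mul_one]

lemma not_Ico (n : ℕ) (j : ℤ) (h : j ∉ Finset.Ico (-(n:ℤ)) n) : (n:ℤ) ≤ |j| := by
  rw [Finset.mem_Ico] at h
  by_contra hc
  push Not at hc
  rw [abs_lt] at hc
  exact h ⟨hc.1.le, hc.2⟩

lemma stage2 : ∃ C : ℝ, 0 < C ∧ ∀ τ : ℝ, 0 < τ → ∀ n : ℕ, 2 ≤ n → ∀ (v : ℝ) (m : ℤ), v = m / n →
    ‖SS τ v - Sn n τ v‖ ≤ C / (n * τ ^ 2) ∧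
    (τ ≤ 1 → om v * ‖SS τ v - Sn n τ v‖ ≤ C / n) := by
  obtain ⟨D, hD, hd⟩ := supab_bound
  obtain ⟨D1, hD1, hd1⟩ := supa_out
  obtain ⟨D', hD', hd'⟩ := d2ab_bound
  obtain ⟨D2, hD2, hd2⟩ := d2a_out
  have p1 : 0 ≤ Real.sqrt (Real.pi / (2/9)) := Real.sqrt_nonneg _
  have p2 : 0 ≤ Real.sqrt (Real.pi / (1/9)) := Real.sqrt_nonneg _
  refine ⟨(D + D1) * Real.sqrt (Real.pi / (2/9)) + (D' + D2) * (Real.sqrt (Real.pi / (1/9)) + 1), by positivity, ?_⟩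
  intro τ hτ n hn v m hv
  have hn0 : (0:ℝ) < n := by positivity
  have hg0 : ∀ j, 0 ≤ g0 (2/9) τ j := fun j => by unfold g0; split_ifs <;> positivity
  have hgg : ∀ j, 0 ≤ gg (1/9) τ j := fun j => by unfold gg; positivity
  constructor
  · obtain ⟨h1, h2⟩ := tsum_smul_gauss0 (2/9) (by norm_num) τ hτ ((D + D1) / (n * τ)) (by positivity)
    refine (tsum_diff_bd (aZ τ) (bZ n τ) (Finset.Ico (-(n:ℤ)) n) _ v _ (summable_mul_Ez _ (aZ_summable τ hτ) v) h1 h2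
      (fun j hj => (hd τ hτ n hn j hj).trans ?_) (fun j hj => (hd1 τ hτ n hn j (not_Ico n j hj)).trans ?_)).trans ?_
    · have := hg0 j
      gcongr; linarith
    · have := hg0 j
      gcongr; linarith
    have : (D + D1) / (n * τ) * (Real.sqrt (Real.pi / (2/9)) / τ) = ((D + D1) * Real.sqrt (Real.pi / (2/9))) / (n * τ ^ 2) := by
      field_simp
    rw [this]
    gcongr
    have : 0 ≤ (D' + D2) * (Real.sqrt (Real.pi / (1/9)) + 1) := by positivity
    linarith
  · intro hτ1
    obtain ⟨h1, h2⟩ := tsum_smul_gauss (1/9) (by norm_num) τ hτ hτ1 ((D' + D2) * (τ / n)) (by positivity)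
    have hds : Summable fun j => d2 (aZ τ) j * Ez v j := by
      refine summable_mul_Ez _ ?_ v
      have hs := aZ_summable τ hτ
      have s1 : Summable fun j : ℤ => ‖aZ τ (j - 1)‖ :=
        (Equiv.subRight (1:ℤ)).summable_iff (f := fun j => ‖aZ τ j‖) |>.2 hs
      have s2 : Summable fun j : ℤ => ‖aZ τ (j + 1)‖ :=
        (Equiv.addRight (1:ℤ)).summable_iff (f := fun j => ‖aZ τ j‖) |>.2 hs
      refine Summable.of_nonneg_of_le (fun j => norm_nonneg _) (fun j => ?_) (((hs.mul_left 2).add s1).add s2)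
      unfold d2
      refine (norm_sub_le _ _).trans ?_
      gcongr
      refine (norm_sub_le _ _).trans ?_
      gcongr
      rw [norm_mul, Complex.norm_two]
    have h := tsum_diff_bd (d2 (aZ τ)) (d2 (bZ n τ)) (Finset.Ico (-(n:ℤ)) n) _ v _ hds h1 h2
      (fun j hj => (hd' τ hτ hτ1 n hn j hj).trans (by
        have := hgg j
        gcongr; linarith)) (fun j hj => (hd2 τ hτ hτ1 n hn j (not_Ico n j hj)).trans (by
        have := hgg j
        gcongr; linarith))
    rw [← abel_tsum _ (aZ_summable τ hτ), ← abel_fin _ n (bZ_per n (by omega) τ) v (Ez_per n (by omega) v m hv),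
      ← mul_sub, norm_om_mul] at h
    change 4 * om v * ‖SS τ v - Sn n τ v‖ ≤ _ at h
    have e2 : (D' + D2) * (τ / n) * ((Real.sqrt (Real.pi / (1/9)) + 1) / τ) = (D' + D2) * (Real.sqrt (Real.pi / (1/9)) + 1) / n := by
      field_simp
    rw [e2] at h
    have o := mul_nonneg (om_nonneg v) (norm_nonneg (SS τ v - Sn n τ v))
    rw [add_div]
    have : 0 ≤ (D + D1) * Real.sqrt (Real.pi / (2/9)) / n := by positivity
    nlinarith

lemma om_transfer (n : ℕ) (hn : 0 < n) (u v : ℝ) (h : |u - v| ≤ 2 / n) :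
    om u ≤ 2 * om v + 2 * Real.pi ^ 2 / n ^ 2 := by
  have hn0 : (0:ℝ) < n := by exact_mod_cast hn
  have hpi := Real.pi_pos
  have h1 : |Real.sin (Real.pi * u / 2) - Real.sin (Real.pi * v / 2)| ≤ Real.pi / n := by
    rw [Real.sin_sub_sin, abs_mul, abs_mul]
    have a1 := Real.abs_sin_le_abs (x := (Real.pi * u / 2 - Real.pi * v / 2) / 2)
    have a2 := Real.abs_cos_le_one ((Real.pi * u / 2 + Real.pi * v / 2) / 2)
    have e : (Real.pi * u / 2 - Real.pi * v / 2) / 2 = Real.pi / 4 * (u - v) := by ring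
    rw [e] at a1 ⊢
    rw [abs_mul, abs_of_pos (by positivity : 0 < Real.pi / 4)] at a1
    rw [abs_two]
    calc _ ≤ 2 * (Real.pi / 4 * (2 / n)) * 1 := by
          gcongr
          exact a1.trans (by gcongr)
      _ = _ := by ring
  have h2 : (Real.sin (Real.pi * u / 2) - Real.sin (Real.pi * v / 2)) ^ 2 ≤ (Real.pi / n) ^ 2 := by
    rw [← sq_abs]; gcongr
  rw [div_pow] at h2
  unfold om
  rw [mul_div_assoc 2 (Real.pi ^ 2)]
  nlinarith [sq_nonneg (Real.sin (Real.pi * u / 2) - 2 * Real.sin (Real.pi * v / 2))]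

lemma stage12 : ∃ C : ℝ, 0 < C ∧ ∀ τ : ℝ, 0 < τ → ∀ n : ℕ, 2 ≤ n → ∀ (u v : ℝ) (m : ℤ), v = m / n →
    |u - v| ≤ 2 / n →
    ‖SS τ u - Sn n τ v‖ ≤ C / (n * τ ^ 2) ∧
    (τ ≤ 1 → 1 ≤ n * τ → om u * ‖SS τ u - Sn n τ v‖ ≤ C / n) := by
  obtain ⟨C1, hC1, h1⟩ := stage1
  obtain ⟨C2, hC2, h2⟩ := stage2
  have hpi := Real.pi_pos
  refine ⟨C1 + 2 * C2 + 2 * Real.pi ^ 2 * C2, by positivity, ?_⟩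
  intro τ hτ n hn u v m hv huv
  have hn0 : (0:ℝ) < n := by positivity
  obtain ⟨a1, a2⟩ := h1 τ hτ n hn u v huv
  obtain ⟨b1, b2⟩ := h2 τ hτ n hn v m hv
  have tri : ‖SS τ u - Sn n τ v‖ ≤ ‖SS τ u - SS τ v‖ + ‖SS τ v - Sn n τ v‖ := norm_sub_le_norm_sub_add_norm_sub _ _ _
  constructor
  · refine (tri.trans (add_le_add a1 b1)).trans ?_
    rw [← add_div]
    refine div_le_div_of_nonneg_right ?_ (by positivity)
    nlinarith [mul_pos (pow_pos hpi 2) hC2]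
  · intro hτ1 hnτ
    have ho := om_transfer n (by omega) u v huv
    have c1 := a2 hτ1 hnτ
    have c2 := b2 hτ1
    have c3 : om u * ‖SS τ v - Sn n τ v‖ ≤ 2 * C2 / n + 2 * Real.pi ^ 2 * C2 / n := by
      calc _ ≤ (2 * om v + 2 * Real.pi ^ 2 / n ^ 2) * ‖SS τ v - Sn n τ v‖ := by gcongr
        _ = 2 * (om v * ‖SS τ v - Sn n τ v‖) + 2 * Real.pi ^ 2 / n ^ 2 * ‖SS τ v - Sn n τ v‖ := by ring
        _ ≤ 2 * (C2 / n) + 2 * Real.pi ^ 2 / n ^ 2 * (C2 / (n * τ ^ 2)) := by gcongr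
        _ = 2 * C2 / n + 2 * Real.pi ^ 2 * C2 / (n * (n * τ) ^ 2) := by field_simp
        _ ≤ 2 * C2 / n + 2 * Real.pi ^ 2 * C2 / n := by
            gcongr
            exact le_mul_of_one_le_right hn0.le (one_le_pow₀ hnτ)
    calc om u * ‖SS τ u - Sn n τ v‖ ≤ om u * (‖SS τ u - SS τ v‖ + ‖SS τ v - Sn n τ v‖) :=
          mul_le_mul_of_nonneg_left tri (om_nonneg u)
      _ ≤ C1 / n + (2 * C2 / n + 2 * Real.pi ^ 2 * C2 / n) := by rw [mul_add]; exact add_le_add c1 c3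
      _ = _ := by ring

lemma Sn_small : ∃ C : ℝ, 0 < C ∧ ∀ τ : ℝ, 0 < τ → ∀ n : ℕ, 2 ≤ n → n * τ ≤ 1 → ∀ (u v : ℝ) (m : ℤ), v = m / n →
    |u - v| ≤ 2 / n →
    ‖Sn n τ v‖ ≤ C * n ∧ om u * ‖Sn n τ v‖ ≤ C / n := by
  have hpi := Real.pi_pos
  refine ⟨2 + 12 * Real.pi ^ 2, by positivity, ?_⟩
  intro τ hτ n hn hnτ u v m hv huv
  have hn0 : (0:ℝ) < n := by positivity
  have card : ((Finset.Ico (-(n:ℤ)) n).card : ℝ) = 2 * n := by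
    rw [Int.card_Ico]
    have : ((n:ℤ) - -(n:ℤ)).toNat = 2 * n := by omega
    rw [this]; push_cast; ring
  have h1 : ‖Sn n τ v‖ ≤ 2 * n := by
    unfold Sn
    refine (norm_sum_le_of_le _ (fun j _ => ?_ : ∀ j ∈ Finset.Ico (-(n:ℤ)) n, _ ≤ (1:ℝ))).trans (le_of_eq ?_)
    · rw [norm_mul, Ez_norm, mul_one]
      unfold bZ
      rw [Complex.norm_real, Real.norm_eq_abs, abs_of_pos (bR_pos _ _ _)]
      exact bR_le_one _ _ _
    · rw [Finset.sum_const, nsmul_eq_mul, card, mul_one]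
  have h2 : 4 * om v * ‖Sn n τ v‖ ≤ 12 * Real.pi ^ 2 / n := by
    rw [← norm_om_mul]
    unfold Sn
    rw [abel_fin _ n (bZ_per n (by omega) τ) v (Ez_per n (by omega) v m hv)]
    refine (norm_sum_le_of_le _ (fun j _ => ?_ : ∀ j ∈ Finset.Ico (-(n:ℤ)) n, _ ≤ (6 * Real.pi ^ 2 * τ ^ 2))).trans ?_
    · rw [norm_mul, Ez_norm, mul_one]
      exact d2b_small τ hτ n hn hnτ j
    · rw [Finset.sum_const, nsmul_eq_mul, card]
      rw [le_div_iff₀ hn0]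
      have : (n * τ) ^ 2 ≤ 1 := pow_le_one₀ (by positivity) hnτ
      calc _ = 12 * Real.pi ^ 2 * (n * τ) ^ 2 := by ring
        _ ≤ 12 * Real.pi ^ 2 * 1 := by gcongr
        _ = _ := by ring
  constructor
  · refine h1.trans ?_
    gcongr
    have := pow_pos hpi 2
    linarith
  · have ho := om_transfer n (by omega) u v huv
    have o := mul_nonneg (om_nonneg v) (norm_nonneg (Sn n τ v))
    calc _ ≤ (2 * om v + 2 * Real.pi ^ 2 / n ^ 2) * ‖Sn n τ v‖ := by gcongr
      _ = (4 * om v * ‖Sn n τ v‖) / 2 + 2 * Real.pi ^ 2 / n ^ 2 * ‖Sn n τ v‖ := by ring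
      _ ≤ (12 * Real.pi ^ 2 / n) / 2 + 2 * Real.pi ^ 2 / n ^ 2 * (2 * n) := by gcongr
      _ = 10 * Real.pi ^ 2 / n := by field_simp; ring
      _ ≤ _ := by
        gcongr
        have := pow_pos hpi 2
        linarith

lemma cos_diff (x y t : ℝ) : Real.cos (Real.pi * (x - y) * t) - Real.cos (Real.pi * (x + y) * t)
    = 2 * Real.sin (Real.pi * x * t) * Real.sin (Real.pi * y * t) := by
  have e1 : Real.pi * (x - y) * t = Real.pi * x * t - Real.pi * y * t := by ring
  have e2 : Real.pi * (x + y) * t = Real.pi * x * t + Real.pi * y * t := by ring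
  rw [e1, e2, Real.cos_sub, Real.cos_add]; ring

lemma phiF_mul (j : ℕ) (x y : ℝ) :
    phiF j x * phiF j y = 2 * Real.sin (Real.pi * x * j) * Real.sin (Real.pi * y * j) := by
  unfold phiF
  have : Real.sqrt 2 * Real.sqrt 2 = 2 := Real.mul_self_sqrt (by norm_num)
  have e1 : (j:ℝ) * Real.pi * x = Real.pi * x * j := by ring
  have e2 : (j:ℝ) * Real.pi * y = Real.pi * y * j := by ring
  rw [e1, e2]
  linear_combination (Real.sin (Real.pi * x * j) * Real.sin (Real.pi * y * j)) * this

noncomputable def HH (c : ℤ → ℝ) (x y : ℝ) (j : ℤ) : ℝ :=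
  c j * (2 * Real.sin (Real.pi * x * j) * Real.sin (Real.pi * y * j))

lemma HH_neg (c : ℤ → ℝ) (hc : ∀ j, c (-j) = c j) (x y : ℝ) (j : ℤ) : HH c x y (-j) = HH c x y j := by
  unfold HH
  rw [hc]; push_cast
  rw [mul_neg, mul_neg, Real.sin_neg, Real.sin_neg]; ring

lemma HH_re (c : ℤ → ℝ) (x y : ℝ) (j : ℤ) :
    ((c j : ℂ) * Ez (x - y) j).re - ((c j : ℂ) * Ez (x + y) j).re = HH c x y j := by
  rw [Complex.re_ofReal_mul, Complex.re_ofReal_mul, Ez_re, Ez_re, ← mul_sub, cos_diff]; rfl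

lemma G_rep (τ x y : ℝ) (hτ : 0 < τ) :
    G (τ ^ 2) x y = ((SS τ (x - y)).re - (SS τ (x + y)).re) / 2 := by
  have hs1 := summable_mul_Ez _ (aZ_summable τ hτ) (x - y)
  have hs2 := summable_mul_Ez _ (aZ_summable τ hτ) (x + y)
  have hH : HasSum (HH (fun j => aR τ j) x y) ((SS τ (x - y)).re - (SS τ (x + y)).re) := by
    have := (Complex.hasSum_re hs1.hasSum).sub (Complex.hasSum_re hs2.hasSum)
    refine this.congr_fun ?_ 
    intro j
    exact (HH_re (fun j => aR τ j) x y j).symm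
  have hce : ∀ j : ℤ, (fun j : ℤ => aR τ j) (-j) = (fun j : ℤ => aR τ j) j := by
    intro j; simp only [aR]; push_cast; congr 1; ring
  have s1 : Summable (fun j : ℕ => HH (fun j => aR τ j) x y ((j:ℤ) + 1)) :=
    hH.summable.comp_injective (i := fun j : ℕ => (j:ℤ) + 1) (fun a b h => by simpa using h)
  have s2 : Summable (fun j : ℕ => HH (fun j => aR τ j) x y (-((j:ℤ) + 1))) := by
    simpa only [HH_neg (fun j : ℤ => aR τ j) hce] using s1
  have h0 : HH (fun j => aR τ j) x y 0 = 0 := by simp [HH]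
  rw [← hH.tsum_eq, tsum_of_add_one_of_neg_add_one s1 s2, h0]
  simp only [HH_neg (fun j : ℤ => aR τ j) hce]
  unfold G
  rw [add_zero, add_self_div_two]
  congr 1
  funext j
  rw [mul_assoc, phiF_mul]
  unfold HH aR
  push_cast
  congr 2
  ring

lemma sum_Ico_sym (h : ℤ → ℝ) (m : ℕ) :
    ∑ j ∈ Finset.Ico (-((m+1 : ℕ):ℤ)) ((m+1 : ℕ):ℤ), h j =
      h (-((m:ℤ)+1)) + h 0 + ∑ j ∈ Finset.Icc 1 m, (h j + h (-(j:ℤ))) := by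
  induction m with
  | zero =>
    have : Finset.Ico (-((0+1 : ℕ):ℤ)) ((0+1 : ℕ):ℤ) = {-1, 0} := by decide
    rw [this]; simp
  | succ m ih =>
    have : Finset.Ico (-((m+1+1 : ℕ):ℤ)) ((m+1+1 : ℕ):ℤ) =
        insert (-((m:ℤ)+2)) (insert ((m:ℤ)+1) (Finset.Ico (-((m+1 : ℕ):ℤ)) ((m+1 : ℕ):ℤ))) := by
      ext k; simp only [Finset.mem_Ico, Finset.mem_insert]; push_cast; omega
    rw [this, Finset.sum_insert, Finset.sum_insert, ih, Finset.sum_Icc_succ_top (by omega)]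
    · push_cast
      have : -((m:ℤ)+1+1) = -((m:ℤ)+2) := by ring
      rw [this]; ring
    · simp
    · simp only [Finset.mem_Ico, Finset.mem_insert]; push_cast; omega

noncomputable def Tn (n : ℕ) (t a b : ℝ) : ℝ :=
  ∑ j ∈ Finset.Icc 1 (n - 1), Real.exp (lamn n j * t) * phiF j a * phiF j b

lemma Tn_rep (n : ℕ) (hn : 2 ≤ n) (τ : ℝ) (a b : ℝ) (k : ℤ) (ha : a = k / n) :
    Tn n (τ ^ 2) a b = ((Sn n τ (a - b)).re - (Sn n τ (a + b)).re) / 2 := by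
  obtain ⟨m, rfl⟩ : ∃ m, n = m + 1 := ⟨n - 1, by omega⟩
  have hn0 : ((m + 1 : ℕ):ℝ) ≠ 0 := by positivity
  unfold Sn
  rw [Complex.re_sum, Complex.re_sum, ← Finset.sum_sub_distrib]
  have e : ∀ j ∈ Finset.Ico (-((m+1 : ℕ):ℤ)) ((m+1 : ℕ):ℤ),
      (bZ (m+1) τ j * Ez (a - b) j).re - (bZ (m+1) τ j * Ez (a + b) j).re
        = HH (fun j => bR (m+1) τ j) a b j := fun j _ => HH_re (fun j => bR (m+1) τ j) a b j
  rw [Finset.sum_congr rfl e, sum_Ico_sym]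
  have hce : ∀ j : ℤ, (fun j : ℤ => bR (m+1) τ j) (-j) = (fun j : ℤ => bR (m+1) τ j) j := by
    intro j; simp only [bR, mu]; push_cast; rw [mul_neg, neg_div, Real.cos_neg]
  have h0 : HH (fun j => bR (m+1) τ j) a b 0 = 0 := by simp [HH]
  have hnn : HH (fun j => bR (m+1) τ j) a b (-((m:ℤ)+1)) = 0 := by
    rw [HH_neg (fun j : ℤ => bR (m+1) τ j) hce]
    unfold HH
    have : Real.pi * a * (((m:ℤ)+1 : ℤ):ℝ) = k * Real.pi := by
      rw [ha]; push_cast at hn0 ⊢; field_simp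
    rw [this, Real.sin_int_mul_pi]; ring
  rw [h0, hnn]
  simp only [HH_neg (fun j : ℤ => bR (m+1) τ j) hce]
  unfold Tn
  rw [Nat.add_sub_cancel, zero_add, zero_add, Finset.sum_div]
  refine Finset.sum_congr rfl fun j _ => ?_
  rw [mul_assoc, phiF_mul, add_self_div_two]
  unfold HH bR lamn
  simp only [mu_sin]
  push_cast
  congr 2
  have : (j:ℝ) * Real.pi / (2 * ((m:ℝ)+1)) = Real.pi * j / (2 * ((m:ℝ)+1)) := by ring
  rw [this]
  ring

lemma Gn_rep (n : ℕ) (t x y : ℝ) :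
    Gn n t x y = (1 - ((n:ℝ) * x - ⌊(n:ℝ) * x⌋)) * Tn n t ((⌊(n:ℝ) * x⌋ : ℝ) / n) (kappa n y)
      + ((n:ℝ) * x - ⌊(n:ℝ) * x⌋) * Tn n t (((⌊(n:ℝ) * x⌋ : ℝ) + 1) / n) (kappa n y) := by
  unfold Gn Tn phiLin
  rw [Finset.mul_sum, Finset.mul_sum, ← Finset.sum_add_distrib]
  refine Finset.sum_congr rfl fun j _ => ?_
  ring

lemma half_re (z w : ℂ) (B : ℝ) (hz : ‖z‖ ≤ B) (hw : ‖w‖ ≤ B) : |(z.re - w.re) / 2| ≤ B := by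
  have h1 := (Complex.abs_re_le_norm z).trans hz
  have h2 := (Complex.abs_re_le_norm w).trans hw
  rw [abs_le] at *
  constructor <;> linarith [h1.1, h1.2, h2.1, h2.2]

lemma G_pw (τ x y B : ℝ) (hτ : 0 < τ) (h : ∀ u, (u = x - y ∨ u = x + y) → ‖SS τ u‖ ≤ B) :
    |G (τ ^ 2) x y| ≤ B := by
  rw [G_rep τ x y hτ]
  exact half_re _ _ _ (h _ (Or.inl rfl)) (h _ (Or.inr rfl))

lemma frac_facts (n : ℕ) (hn : 2 ≤ n) (x : ℝ) : 0 ≤ (n:ℝ) * x - ⌊(n:ℝ) * x⌋ ∧ (n:ℝ) * x - ⌊(n:ℝ) * x⌋ ≤ 1 ∧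
    |x - (⌊(n:ℝ) * x⌋ : ℝ) / n| ≤ 1 / n ∧ |x - ((⌊(n:ℝ) * x⌋ : ℝ) + 1) / n| ≤ 1 / n := by
  have hn0 : (0:ℝ) < n := by positivity
  have h1 := Int.floor_le ((n:ℝ) * x)
  have h2 := (Int.lt_floor_add_one ((n:ℝ) * x)).le
  refine ⟨by linarith, by linarith, ?_, ?_⟩
  · have : x - (⌊(n:ℝ) * x⌋ : ℝ) / n = ((n:ℝ) * x - ⌊(n:ℝ) * x⌋) / n := by field_simp
    rw [this, abs_div, abs_of_pos hn0]
    gcongr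
    exact abs_le.2 ⟨by linarith, by linarith⟩
  · have : x - ((⌊(n:ℝ) * x⌋ : ℝ) + 1) / n = ((n:ℝ) * x - ⌊(n:ℝ) * x⌋ - 1) / n := by field_simp; ring
    rw [this, abs_div, abs_of_pos hn0]
    gcongr
    exact abs_le.2 ⟨by linarith, by linarith⟩

lemma conv_abs (θ a b B : ℝ) (h0 : 0 ≤ θ) (h1 : θ ≤ 1) (ha : |a| ≤ B) (hb : |b| ≤ B) :
    |(1 - θ) * a + θ * b| ≤ B := by
  refine (abs_add_le _ _).trans ?_
  rw [abs_mul, abs_mul, abs_of_nonneg h0, abs_of_nonneg (by linarith : 0 ≤ 1 - θ)]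
  nlinarith

lemma grid_pair (n : ℕ) (hn : 2 ≤ n) (x y a : ℝ) (k : ℤ) (ha : a = k / n) (hxa : |x - a| ≤ 1 / n) :
    (a - kappa n y = ((k - ⌊(n:ℝ) * y⌋ : ℤ) : ℝ) / n ∧ |(x - y) - (a - kappa n y)| ≤ 2 / n) ∧
    (a + kappa n y = ((k + ⌊(n:ℝ) * y⌋ : ℤ) : ℝ) / n ∧ |(x + y) - (a + kappa n y)| ≤ 2 / n) := by
  have hk := (frac_facts n hn y).2.2.1
  have e : (2:ℝ) / n = 1 / n + 1 / n := by ring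
  change |y - kappa n y| ≤ 1 / n at hk
  refine ⟨⟨?_, ?_⟩, ⟨?_, ?_⟩⟩
  · unfold kappa; rw [ha]; push_cast; ring
  · rw [abs_le] at *; constructor <;> linarith [hk.1, hk.2, hxa.1, hxa.2]
  · unfold kappa; rw [ha]; push_cast; ring
  · rw [abs_le] at *; constructor <;> linarith [hk.1, hk.2, hxa.1, hxa.2]

lemma Gn_pw (n : ℕ) (hn : 2 ≤ n) (τ x y B : ℝ)
    (h : ∀ (u v : ℝ) (m : ℤ), (u = x - y ∨ u = x + y) → v = m / n → |u - v| ≤ 2 / n → ‖Sn n τ v‖ ≤ B) :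
    |Gn n (τ ^ 2) x y| ≤ B := by
  obtain ⟨f0, f1, f2, f3⟩ := frac_facts n hn x
  rw [Gn_rep]
  have key : ∀ (a : ℝ) (k : ℤ), a = k / n → |x - a| ≤ 1 / n → |Tn n (τ ^ 2) a (kappa n y)| ≤ B := by
    intro a k ha hxa
    obtain ⟨⟨g1, g2⟩, ⟨g3, g4⟩⟩ := grid_pair n hn x y a k ha hxa
    rw [Tn_rep n hn τ a _ k ha]
    exact half_re _ _ _ (h _ _ _ (Or.inl rfl) g1 g2) (h _ _ _ (Or.inr rfl) g3 g4)
  exact conv_abs _ _ _ _ f0 f1 (key _ ⌊(n:ℝ) * x⌋ rfl f2) (key _ (⌊(n:ℝ) * x⌋ + 1) (by push_cast; ring) f3)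

lemma GGn_pw (n : ℕ) (hn : 2 ≤ n) (τ x y B : ℝ) (hτ : 0 < τ)
    (h : ∀ (u v : ℝ) (m : ℤ), (u = x - y ∨ u = x + y) → v = m / n → |u - v| ≤ 2 / n →
      ‖SS τ u - Sn n τ v‖ ≤ B) :
    |G (τ ^ 2) x y - Gn n (τ ^ 2) x y| ≤ B := by
  obtain ⟨f0, f1, f2, f3⟩ := frac_facts n hn x
  rw [Gn_rep]
  have key : ∀ (a : ℝ) (k : ℤ), a = k / n → |x - a| ≤ 1 / n →
      |G (τ ^ 2) x y - Tn n (τ ^ 2) a (kappa n y)| ≤ B := by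
    intro a k ha hxa
    obtain ⟨⟨g1, g2⟩, ⟨g3, g4⟩⟩ := grid_pair n hn x y a k ha hxa
    rw [Tn_rep n hn τ a _ k ha, G_rep τ x y hτ]
    have := half_re _ _ _ (h _ _ _ (Or.inl rfl) g1 g2) (h _ _ _ (Or.inr rfl) g3 g4)
    rw [Complex.sub_re, Complex.sub_re] at this
    refine le_of_eq_of_le ?_ this
    congr 1; ring
  have := conv_abs _ _ _ _ f0 f1 (key _ ⌊(n:ℝ) * x⌋ rfl f2) (key _ (⌊(n:ℝ) * x⌋ + 1) (by push_cast; ring) f3)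
  refine le_of_eq_of_le ?_ this
  congr 1; ring

/-- Cauchy-type majorant -/
noncomputable def KK (A h c y : ℝ) : ℝ := 2 * A / (1 + ((y - c) / h) ^ 2)
noncomputable def K3 (A h x y : ℝ) : ℝ := KK A h x y + KK A h (-x) y + KK A h (2 - x) y

lemma KK_nonneg (A h c y : ℝ) (hA : 0 ≤ A) : 0 ≤ KK A h c y := by unfold KK; positivity

lemma KK_dom (A h c y p : ℝ) (hh : 0 < h) (hp : p ≤ A) (hw : (y - c) ^ 2 * p ≤ A * h ^ 2) : p ≤ KK A h c y := by
  unfold KK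
  rw [le_div_iff₀ (by positivity), div_pow]
  have : (y - c) ^ 2 / h ^ 2 * p ≤ A := by
    rw [div_mul_eq_mul_div, div_le_iff₀ (by positivity)]; exact hw
  linarith

lemma om_low (u : ℝ) (h : |u| ≤ 1) : u ^ 2 ≤ om u := by
  have hpi := Real.pi_pos
  have h1 : |u| ≤ Real.sin (Real.pi * |u| / 2) := by
    have := Real.mul_le_sin (x := Real.pi * |u| / 2) (by positivity) (by nlinarith)
    refine le_of_eq_of_le ?_ this
    field_simp
  unfold om
  have e : Real.sin (Real.pi * |u| / 2) ^ 2 = Real.sin (Real.pi * u / 2) ^ 2 := by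
    rcases abs_choice u with h | h <;> rw [h]
    rw [mul_neg, neg_div, Real.sin_neg, neg_sq]
  rw [← e, ← sq_abs]
  gcongr

lemma om_refl (u : ℝ) : om (2 - u) = om u := by
  unfold om
  have : Real.pi * (2 - u) / 2 = Real.pi - Real.pi * u / 2 := by ring
  rw [this, Real.sin_pi_sub]

lemma K3_dom (A h x y u p : ℝ) (hx : x ∈ Set.Icc (0:ℝ) 1) (hy : y ∈ Set.Icc (0:ℝ) 1) (hA : 0 ≤ A) (hh : 0 < h)
    (hu : u = x - y ∨ u = x + y) (hp0 : 0 ≤ p) (hp : p ≤ A) (hw : om u * p ≤ A * h ^ 2) : p ≤ K3 A h x y := by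
  have k1 := KK_nonneg A h x y hA
  have k2 := KK_nonneg A h (-x) y hA
  have k3 := KK_nonneg A h (2 - x) y hA
  obtain ⟨hx0, hx1⟩ := hx
  obtain ⟨hy0, hy1⟩ := hy
  unfold K3
  rcases hu with rfl | rfl
  · have := om_low (x - y) (abs_le.2 ⟨by linarith, by linarith⟩)
    have := KK_dom A h x y p hh hp (by nlinarith)
    linarith
  · rcases le_total (x + y) 1 with hc | hc
    · have := om_low (x + y) (abs_le.2 ⟨by linarith, by linarith⟩)
      have := KK_dom A h (-x) y p hh hp (by nlinarith)
      linarith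
    · have := om_low (2 - (x + y)) (abs_le.2 ⟨by linarith, by linarith⟩)
      rw [om_refl] at this
      have := KK_dom A h (2 - x) y p hh hp (by nlinarith)
      linarith

lemma KK_int (A h c : ℝ) (hA : 0 ≤ A) (hh : 0 < h) : Integrable (KK A h c) ∧
    ∫ y in Set.Icc (0:ℝ) 1, KK A h c y ≤ 2 * Real.pi * A * h := by
  have e : KK A h c = fun y => 2 * A * (fun z : ℝ => (1 + z ^ 2)⁻¹) ((y - c) / h) := by
    funext y; rfl
  have i0 : Integrable (fun z : ℝ => (1 + z ^ 2)⁻¹) := integrable_inv_one_add_sq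
  have i1 : Integrable (fun y : ℝ => (fun z : ℝ => (1 + z ^ 2)⁻¹) ((y - c) / h)) :=
    (i0.comp_div hh.ne').comp_sub_right c
  have i2 : Integrable (KK A h c) := by rw [e]; exact i1.const_mul _
  refine ⟨i2, ?_⟩
  refine (setIntegral_le_integral i2 (Filter.Eventually.of_forall fun y => KK_nonneg A h c y hA)).trans (le_of_eq ?_)
  rw [e, integral_const_mul, integral_sub_right_eq_self (fun y : ℝ => (fun z : ℝ => (1 + z ^ 2)⁻¹) (y / h)) c,
    Measure.integral_comp_div (fun z : ℝ => (1 + z ^ 2)⁻¹) h, integral_univ_inv_one_add_sq, abs_of_pos hh, smul_eq_mul]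
  ring

lemma int_dom (A h x : ℝ) (hA : 0 ≤ A) (hh : 0 < h) (f : ℝ → ℝ)
    (hf : ∀ y ∈ Set.Icc (0:ℝ) 1, |f y| ≤ K3 A h x y) :
    ∫ y in Set.Icc (0:ℝ) 1, |f y| ≤ 6 * Real.pi * A * h := by
  obtain ⟨a1, a2⟩ := KK_int A h x hA hh
  obtain ⟨b1, b2⟩ := KK_int A h (-x) hA hh
  obtain ⟨c1, c2⟩ := KK_int A h (2 - x) hA hh
  have hi : IntegrableOn (K3 A h x) (Set.Icc 0 1) := ((a1.add b1).add c1).integrableOn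
  calc _ ≤ ∫ y in Set.Icc (0:ℝ) 1, K3 A h x y := by
        refine integral_mono_of_nonneg (Filter.Eventually.of_forall fun y => abs_nonneg _) hi ?_
        exact (ae_restrict_iff' measurableSet_Icc).2 (Filter.Eventually.of_forall hf)
    _ = (∫ y in Set.Icc (0:ℝ) 1, KK A h x y) + (∫ y in Set.Icc (0:ℝ) 1, KK A h (-x) y)
        + ∫ y in Set.Icc (0:ℝ) 1, KK A h (2 - x) y := by
        unfold K3
        rw [integral_add, integral_add]
        · exact a1.integrableOn
        · exact b1.integrableOn
        · exact (a1.add b1).integrableOn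
        · exact c1.integrableOn
    _ ≤ _ := by linarith

lemma int_sup (B : ℝ) (f : ℝ → ℝ) (hf : ∀ y ∈ Set.Icc (0:ℝ) 1, |f y| ≤ B) :
    ∫ y in Set.Icc (0:ℝ) 1, |f y| ≤ B := by
  calc _ ≤ ∫ y in Set.Icc (0:ℝ) 1, B := by
        refine integral_mono_of_nonneg (Filter.Eventually.of_forall fun y => abs_nonneg _) (integrable_const _) ?_
        exact (ae_restrict_iff' measurableSet_Icc).2 (Filter.Eventually.of_forall hf)
    _ = B := by simp

lemma phiF_abs (j : ℕ) (x : ℝ) : |phiF j x| ≤ Real.sqrt 2 := by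
  unfold phiF
  rw [abs_mul, abs_of_nonneg (Real.sqrt_nonneg 2)]
  exact mul_le_of_le_one_right (Real.sqrt_nonneg 2) (Real.abs_sin_le_one _)

lemma G_term (τ x y : ℝ) (j : ℕ) :
    ‖Real.exp (-((j : ℝ) + 1) ^ 2 * Real.pi ^ 2 * τ ^ 2) * phiF (j + 1) x * phiF (j + 1) y‖
      ≤ 2 * Real.exp (-(Real.pi ^ 2) * (((j:ℝ) + 1) * τ) ^ 2) := by
  rw [norm_mul, norm_mul, Real.norm_eq_abs, Real.norm_eq_abs, Real.norm_eq_abs, Real.abs_exp]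
  have e : -((j : ℝ) + 1) ^ 2 * Real.pi ^ 2 * τ ^ 2 = -(Real.pi ^ 2) * (((j:ℝ) + 1) * τ) ^ 2 := by ring
  rw [e]
  have : Real.sqrt 2 * Real.sqrt 2 = 2 := Real.mul_self_sqrt (by norm_num)
  calc _ ≤ Real.exp (-(Real.pi ^ 2) * (((j:ℝ) + 1) * τ) ^ 2) * Real.sqrt 2 * Real.sqrt 2 := by
        gcongr <;> exact phiF_abs _ _
    _ = _ := by rw [mul_assoc, this, mul_comm]

lemma G_sup (τ x y : ℝ) (hτ : 0 < τ) : |G (τ ^ 2) x y| ≤ Real.sqrt (Real.pi / Real.pi ^ 2) / τ := by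
  have hpi := Real.pi_pos
  obtain ⟨h1, h2⟩ := gaussN (Real.pi ^ 2) (by positivity) τ hτ
  rw [← Real.norm_eq_abs]
  refine (tsum_of_norm_bounded (h1.mul_left 2).hasSum (G_term τ x y)).trans ?_
  rw [tsum_mul_left]
  calc _ ≤ 2 * ((Real.sqrt (Real.pi / Real.pi ^ 2) / 2) / τ) := by gcongr
    _ = _ := by ring

lemma G_int (τ x : ℝ) (hτ : 0 < τ) : IntegrableOn (G (τ ^ 2) x) (Set.Icc 0 1) := by
  have hpi := Real.pi_pos
  obtain ⟨h1, h2⟩ := gaussN (Real.pi ^ 2) (by positivity) τ hτ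
  have : Continuous (G (τ ^ 2) x) := by
    unfold G
    refine continuous_tsum (fun j => ?_) (h1.mul_left 2) (fun j y => G_term τ x y j)
    unfold phiF
    fun_prop
  exact this.integrableOn_Icc

lemma Gn_int (n : ℕ) (t x B : ℝ) (hB : ∀ y ∈ Set.Icc (0:ℝ) 1, |Gn n t x y| ≤ B) :
    IntegrableOn (Gn n t x) (Set.Icc 0 1) := by
  have hm : Measurable (Gn n t x) := by
    unfold Gn phiF kappa
    fun_prop
  refine Measure.integrableOn_of_bounded (M := B) (by simp) hm.aestronglyMeasurable ?_
  exact (ae_restrict_iff' measurableSet_Icc).2 (Filter.Eventually.of_forall hB)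

theorem main1D : Main1D := by
  obtain ⟨Ca, hCa, ha⟩ := SS_bounds
  obtain ⟨Cb, hCb, hb⟩ := stage12
  obtain ⟨Cc, hCc, hc⟩ := Sn_small
  have hpi := Real.pi_pos
  set C1 := Real.sqrt (Real.pi / Real.pi ^ 2) with hC1
  have hC10 : 0 ≤ C1 := Real.sqrt_nonneg _
  set Ia := 6 * Real.pi * Ca with hIa
  set Ib := 6 * Real.pi * Cb with hIb
  set Ic := 6 * Real.pi * Cc with hIc
  have hIa0 : 0 < Ia := by positivity
  have hIb0 : 0 < Ib := by positivity
  have hIc0 : 0 < Ic := by positivity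
  refine ⟨C1 + Cb + Cc + Ia + Ib + Ic, by positivity, ?_⟩
  intro n hn τ hτ x hx
  have hn0 : (0:ℝ) < n := by positivity
  have hG : ∀ y ∈ Set.Icc (0:ℝ) 1, |G (τ ^ 2) x y| ≤ C1 / τ := fun y _ => G_sup τ x y hτ
  have hD : ∀ y ∈ Set.Icc (0:ℝ) 1, |G (τ ^ 2) x y - Gn n (τ ^ 2) x y| ≤ Cb / (n * τ ^ 2) := fun y _ =>
    GGn_pw n hn τ x y _ hτ fun u v m _ hv huv => (hb τ hτ n hn u v m hv huv).1
  have hGn : ∀ y ∈ Set.Icc (0:ℝ) 1, |Gn n (τ ^ 2) x y| ≤ (C1 + Cb + Cc) / τ := by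
    intro y hy
    rcases le_total 1 ((n:ℝ) * τ) with h | h
    · have e : Gn n (τ ^ 2) x y = G (τ ^ 2) x y - (G (τ ^ 2) x y - Gn n (τ ^ 2) x y) := by ring
      rw [e]
      refine (abs_sub _ _).trans ((add_le_add (hG y hy) (hD y hy)).trans ?_)
      have : Cb / (n * τ ^ 2) ≤ Cb / τ := by
        gcongr
        nlinarith
      have h3 : 0 ≤ Cc / τ := by positivity
      rw [add_div, add_div]
      linarith
    · have h1 : |Gn n (τ ^ 2) x y| ≤ Cc * n :=
        Gn_pw n hn τ x y _ fun u v m _ hv huv => (hc τ hτ n hn h u v m hv huv).1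
      refine h1.trans ?_
      rw [le_div_iff₀ hτ]
      nlinarith
  have iG := G_int τ x hτ
  have iGn := Gn_int n (τ ^ 2) x _ hGn
  have aG : IntegrableOn (fun y => |G (τ ^ 2) x y|) (Set.Icc 0 1) := iG.abs
  have aGn : IntegrableOn (fun y => |Gn n (τ ^ 2) x y|) (Set.Icc 0 1) := iGn.abs
  have aD : IntegrableOn (fun y => |G (τ ^ 2) x y - Gn n (τ ^ 2) x y|) (Set.Icc 0 1) := (iG.sub iGn).abs
  have I1 : ∫ y in Set.Icc (0:ℝ) 1, |G (τ ^ 2) x y| ≤ Ia + C1 := by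
    rcases le_total τ 1 with h | h
    · have := int_dom (Ca / τ) τ x (by positivity) hτ (G (τ ^ 2) x) (fun y hy => G_pw τ x y _ hτ fun u hu => by
        obtain ⟨q1, q2⟩ := ha τ u hτ h
        refine K3_dom _ _ x y u _ hx hy (by positivity) hτ hu (norm_nonneg _) q1 (q2.trans (le_of_eq ?_))
        field_simp)
      have e : 6 * Real.pi * (Ca / τ) * τ = Ia := by rw [hIa]; field_simp
      rw [e] at this
      linarith
    · have := int_sup _ _ hG
      have h2 : C1 / τ ≤ C1 := div_le_self hC10 h
      linarith
  have I3 : 1 ≤ (n:ℝ) * τ → ∫ y in Set.Icc (0:ℝ) 1, |G (τ ^ 2) x y - Gn n (τ ^ 2) x y| ≤ (Ib + Cb) / (n * τ) := by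
    intro hnτ
    rcases le_total τ 1 with h | h
    · have := int_dom (Cb / (n * τ ^ 2)) τ x (by positivity) hτ (fun y => G (τ ^ 2) x y - Gn n (τ ^ 2) x y)
        (fun y hy => GGn_pw n hn τ x y _ hτ fun u v m hu hv huv => by
          obtain ⟨q1, q2⟩ := hb τ hτ n hn u v m hv huv
          refine K3_dom _ _ x y u _ hx hy (by positivity) hτ hu (norm_nonneg _) q1 ((q2 h hnτ).trans (le_of_eq ?_))
          field_simp)
      refine this.trans ?_
      have e : 6 * Real.pi * (Cb / (n * τ ^ 2)) * τ = Ib / (n * τ) := by rw [hIb]; field_simp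
      rw [e]
      gcongr
      linarith
    · refine (int_sup _ _ hD).trans ?_
      have : (n:ℝ) * τ ≤ n * τ ^ 2 := by gcongr; nlinarith
      calc Cb / (n * τ ^ 2) ≤ Cb / (n * τ) := by gcongr
        _ ≤ _ := by gcongr; linarith
  have I2 : (n:ℝ) * τ ≤ 1 → ∫ y in Set.Icc (0:ℝ) 1, |Gn n (τ ^ 2) x y| ≤ Ic := by
    intro hnτ
    have := int_dom (Cc * n) (1 / n) x (by positivity) (by positivity) (Gn n (τ ^ 2) x)
        (fun y hy => Gn_pw n hn τ x y _ fun u v m hu hv huv => by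
          obtain ⟨q1, q2⟩ := hc τ hτ n hn hnτ u v m hv huv
          refine K3_dom _ _ x y u _ hx hy (by positivity) (by positivity) hu (norm_nonneg _) q1 (q2.trans (le_of_eq ?_))
          field_simp)
    have e : 6 * Real.pi * (Cc * n) * (1 / n) = Ic := by rw [hIc]; field_simp
    rw [e] at this
    exact this
  refine ⟨iG, iGn, ?_, ?_, ?_, by linarith, ?_, ?_⟩
  · intro y hy
    refine (hG y hy).trans ?_
    refine div_le_div_of_nonneg_right ?_ (by positivity)
    linarith
  · intro y hy
    refine (hGn y hy).trans ?_
    refine div_le_div_of_nonneg_right ?_ (by positivity)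
    linarith
  · intro y hy
    refine (hD y hy).trans ?_
    refine div_le_div_of_nonneg_right ?_ (by positivity)
    linarith
  · rcases le_total 1 ((n:ℝ) * τ) with h | h
    · have t : ∫ y in Set.Icc (0:ℝ) 1, |Gn n (τ ^ 2) x y| ≤ (∫ y in Set.Icc (0:ℝ) 1, |G (τ ^ 2) x y|)
          + ∫ y in Set.Icc (0:ℝ) 1, |G (τ ^ 2) x y - Gn n (τ ^ 2) x y| := by
        rw [← integral_add aG aD]
        refine integral_mono aGn (aG.add aD) fun y => ?_
        have := abs_sub (G (τ ^ 2) x y) (G (τ ^ 2) x y - Gn n (τ ^ 2) x y)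
        rw [sub_sub_cancel] at this
        exact this
      have h2 : (Ib + Cb) / (n * τ) ≤ Ib + Cb := div_le_self (by positivity) h
      have := I3 h
      linarith
    · have := I2 h
      linarith
  · rcases le_total 1 ((n:ℝ) * τ) with h | h
    · refine (I3 h).trans ?_
      refine div_le_div_of_nonneg_right ?_ (by positivity)
      linarith
    · have t : ∫ y in Set.Icc (0:ℝ) 1, |G (τ ^ 2) x y - Gn n (τ ^ 2) x y| ≤ (∫ y in Set.Icc (0:ℝ) 1, |G (τ ^ 2) x y|)
          + ∫ y in Set.Icc (0:ℝ) 1, |Gn n (τ ^ 2) x y| := by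
        rw [← integral_add aG aGn]
        exact integral_mono aD (aG.add aGn) fun y => abs_sub _ _
      have h1 := I2 h
      refine t.trans ?_
      rw [le_div_iff₀ (by positivity)]
      have h5 : (Ia + C1 + Ic) * (n * τ) ≤ (Ia + C1 + Ic) := mul_le_of_le_one_right (by positivity) h
      have h6 : ((∫ y in Set.Icc (0:ℝ) 1, |G (τ ^ 2) x y|) + ∫ y in Set.Icc (0:ℝ) 1, |Gn n (τ ^ 2) x y|) * (n * τ)
          ≤ (Ia + C1 + Ic) * (n * τ) := by gcongr
      linarith

/-- time-integrated uniform `‖·‖_{(α)}²` estimate of `G_d - (G_d)^n`. -/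
theorem stmt_15 (d : ℕ) (hd : 1 ≤ d) (α : ℝ) (hα : α ∈ Set.Ioo (0 : ℝ) (min 2 (d : ℝ))) :
    ∃ C : ℝ, 0 < C ∧ ∀ n : ℕ, 2 ≤ n →
      (∫ t in Set.Ioi (0 : ℝ),
          ⨆ x ∈ Q d, normAlphaSq d α (fun y => Gd d t x y - Gdn d n t x y))
        ≤ C * (n : ℝ) ^ (-(2 - α)) := by
  exact final_of_main main1D d hd α hα
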